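/- arXiv:2403.04718 — 2 statements merged into one kernel-verified Lean document; each statement's English description precedes it below -/
import Mathlib

section
/- (Theorem 3.1, global controllability under periodic drift.) Assume 0 ∈ U and span U = ℝ^m, assume every trajectory of X⁰ is periodic and X⁰ has no equilibrium, and assume that for every x ∈ ℝ^d one has {c + λ·X⁰(x) : c ∈ cone E^U(x), λ ∈ ℝ} = ℝ^d (i.e. the image of cone E^U(x) under the linear projection of ℝ^d modulo the line ℝ·X⁰(x) is everything). Then the system is globally controllable: A^U(x) = ℝ^d for every x ∈ ℝ^d. -/
open Set MeasureTheory
open scoped Pointwise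

noncomputable section

/-- `ℝ^d` as a Euclidean space. -/
abbrev Ed (d : ℕ) := EuclideanSpace ℝ (Fin d)

/-- Conic hull of a set: all finite conic combinations of elements of `S`. -/
def coneHull {V : Type*} [AddCommMonoid V] [Module ℝ V] (S : Set V) : Set V :=
  {y | ∃ (j : ℕ) (v : Fin j → V) (c : Fin j → ℝ),
    (∀ i, v i ∈ S) ∧ (∀ i, 0 ≤ c i) ∧ y = ∑ i, c i • v i}

/-- `(x, u)` is a solution of the affine control system
`ẋ = X⁰(x) + ∑ u_k X^k(x)` on `[0, tf]` with control constrained to `U`: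
`u` is measurable, `U`-valued and essentially bounded on `[0,tf]`, and `x` is
absolutely continuous, given as the integral of the right-hand side. -/
def IsSol {d m : ℕ} (X0 : Ed d → Ed d) (X : Fin m → Ed d → Ed d)
    (U : Set (Fin m → ℝ)) (tf : ℝ) (x : ℝ → Ed d) (u : ℝ → Fin m → ℝ) : Prop :=
  Measurable u ∧ (∀ t ∈ Icc (0:ℝ) tf, u t ∈ U) ∧
    (∃ C, ∀ t ∈ Icc (0:ℝ) tf, ‖u t‖ ≤ C) ∧
    IntervalIntegrable (fun s => X0 (x s) + ∑ k, u s k • X k (x s)) volume 0 tf ∧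
    ∀ t ∈ Icc (0:ℝ) tf, x t = x 0 + ∫ s in (0:ℝ)..t, (X0 (x s) + ∑ k, u s k • X k (x s))

/-- The accessible set `A^U_{tf}(x₀)`. -/
def Access {d m : ℕ} (X0 : Ed d → Ed d) (X : Fin m → Ed d → Ed d)
    (U : Set (Fin m → ℝ)) (tf : ℝ) (x0 : Ed d) : Set (Ed d) :=
  {y | ∃ x u, IsSol X0 X U tf x u ∧ x 0 = x0 ∧ x tf = y}

/-- Pushforward `(exp(−τX⁰)_* Z)(x)` of the vector field `Z` along the flow `φ` of `X⁰`. -/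
def pushf {d : ℕ} (φ : ℝ → Ed d → Ed d) (Z : Ed d → Ed d) (τ : ℝ) (x : Ed d) : Ed d :=
  fderiv ℝ (φ (-τ)) (φ τ x) (Z (φ τ x))

/-- The set `E^U_τ(x)`. -/
def EsetAt {d m : ℕ} (φ : ℝ → Ed d → Ed d) (X : Fin m → Ed d → Ed d)
    (U : Set (Fin m → ℝ)) (τ : ℝ) (x : Ed d) : Set (Ed d) :=
  {v | ∃ u ∈ U, v = ∑ k, u k • pushf φ (X k) τ x}

/-- The set `E^U_{[t₁,t₂]}(x)`. -/
def EIcc {d m : ℕ} (φ : ℝ → Ed d → Ed d) (X : Fin m → Ed d → Ed d)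
    (U : Set (Fin m → ℝ)) (t₁ t₂ : ℝ) (x : Ed d) : Set (Ed d) :=
  ⋃ τ ∈ Icc t₁ t₂, EsetAt φ X U τ x

/-- If `H(p, z)` has strict derivative `(p, z) ↦ B p + z` at a fixed point `(0, x)`, with `B` onto and
vanishing at an interior point of a cone `C`, then `H(·, z)` maps `C` onto a neighborhood of `x`,
uniformly for `z` near `x`. -/
theorem eventually_exists_mem_cone_eq {P E : Type*} [NormedAddCommGroup P] [NormedSpace ℝ P]
    [CompleteSpace P] [NormedAddCommGroup E] [NormedSpace ℝ E] [CompleteSpace E]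
    {H : P × E → E} {B : P →L[ℝ] E} {x : E}
    (hH : HasStrictFDerivAt H
      (B.comp (ContinuousLinearMap.fst ℝ P E) + ContinuousLinearMap.snd ℝ P E) (0, x))
    (hx : H (0, x) = x) (hB : Function.Surjective B) {q : P} (hq : B q = 0) {C : Set P}
    (hC : ∀ ε : ℝ, 0 < ε → ∀ p ∈ C, ε • p ∈ C) (hqC : C ∈ nhds q)
    {N : Set (P × E)} (hN : N ∈ nhds ((0 : P), x)) :
    ∀ᶠ r in nhds (x, x), ∃ p ∈ C, (p, r.1) ∈ N ∧ H (p, r.1) = r.2 := by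
  have hrange : B.range = ⊤ := LinearMap.range_eq_top.2 hB
  set R := B.nonlinearRightInverseOfSurjective hrange with hR
  have hn : 0 < R.nnnorm := B.nonlinearRightInverseOfSurjective_nnnorm_pos hrange
  set a : ℝ := (R.nnnorm : ℝ)⁻¹ with ha
  have ha0 : 0 < a := inv_pos.2 (by exact_mod_cast hn)
  obtain ⟨ρ, hρ, hρC⟩ := Metric.nhds_basis_closedBall.mem_iff.1 hqC
  set M : ℝ := ‖q‖ + ρ with hM
  have hM0 : 0 < M := by positivity
  set κ : ℝ := a * ρ / (2 * (M + ρ)) with hκ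
  have hκ0 : 0 < κ := by positivity
  have hκM : κ * (M + ρ) = a * ρ / 2 := by rw [hκ]; field_simp
  obtain ⟨s, hs, happ⟩ := hH.approximates_deriv_on_nhds (c := ⟨κ, hκ0.le⟩) (Or.inr hκ0)
  obtain ⟨r, hr, hrs⟩ := Metric.mem_nhds_iff.1 (Filter.inter_mem hs hN)
  set ε : ℝ := r / (2 * M) with hε
  have hε0 : 0 < ε := by positivity
  have hεM : ε * M = r / 2 := by rw [hε]; field_simp
  set δ : ℝ := min r (a * ρ * ε / (2 * (2 + κ))) with hδ
  have hδ0 : 0 < δ := by positivity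
  have hδ2 : δ * (2 + κ) ≤ a * ρ * ε / 2 := by
    have : δ ≤ a * ρ * ε / (2 * (2 + κ)) := min_le_right _ _
    calc δ * (2 + κ) ≤ a * ρ * ε / (2 * (2 + κ)) * (2 + κ) := by gcongr
      _ = a * ρ * ε / 2 := by field_simp
  have hmem : ∀ p : P, ‖p‖ ≤ ε * M → ∀ z ∈ Metric.ball x δ, (p, z) ∈ s ∩ N := by
    intro p hp z hz
    apply hrs
    rw [Metric.mem_ball, Prod.dist_eq, max_lt_iff]
    refine ⟨?_, (Metric.mem_ball.1 hz).trans_le (min_le_left _ _)⟩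
    simp only [dist_zero_right]
    linarith
  have hball : ∀ p ∈ Metric.closedBall (ε • q) (ε * ρ), ‖p‖ ≤ ε * M := by
    intro p hp
    rw [Metric.mem_closedBall, dist_eq_norm] at hp
    have h1 : ‖p‖ ≤ ‖p - ε • q‖ + ‖ε • q‖ := by simpa using norm_add_le (p - ε • q) (ε • q)
    rw [norm_smul, Real.norm_of_nonneg hε0.le] at h1
    rw [hM]; linarith
  have hev : Metric.ball x δ ×ˢ Metric.ball x δ ∈ nhds (x, x) :=
    prod_mem_nhds (Metric.ball_mem_nhds _ hδ0) (Metric.ball_mem_nhds _ hδ0)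
  filter_upwards [hev]
  rintro ⟨z, w⟩ ⟨hz, hw⟩
  simp only at hz hw ⊢
  have happz : ApproximatesLinearOn (fun p => H (p, z)) B (Metric.closedBall (ε • q) (ε * ρ))
      ⟨κ, hκ0.le⟩ := by
    intro p hp p' hp'
    have := happ (p, z) (hmem p (hball p hp) z hz).1 (p', z) (hmem p' (hball p' hp') z hz).1
    simpa [Prod.norm_def] using this
  have hsurj := happz.surjOn_closedBall_of_nonlinearRightInverse R (b := ε • q)
    (ε := ε * ρ) (by positivity) subset_rfl
  have hεq : ‖ε • q‖ ≤ ε * M := hball _ (Metric.mem_closedBall_self (by positivity))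
  have hcen : ‖H (ε • q, z) - x‖ ≤ δ + κ * (ε * M + δ) := by
    have h1 := happ (ε • q, z) (hmem _ hεq z hz).1 (0, x)
      (hmem 0 (by rw [norm_zero]; positivity) x (Metric.mem_ball_self hδ0)).1
    have hz' : ‖z - x‖ ≤ δ := by rw [← dist_eq_norm]; exact (Metric.mem_ball.1 hz).le
    have h2 : ‖((ε • q, z) : P × E) - (0, x)‖ ≤ ε * M + δ := by
      rw [Prod.norm_def]
      refine max_le ?_ ?_
      · simp only [Prod.fst_sub, sub_zero]; linarith
      · simp only [Prod.snd_sub]; nlinarith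
    rw [hx] at h1
    have h3 : (B.comp (ContinuousLinearMap.fst ℝ P E) + ContinuousLinearMap.snd ℝ P E)
        (((ε • q, z) : P × E) - (0, x)) = z - x := by simp [hq]
    rw [h3] at h1
    have h4 : ‖H (ε • q, z) - x - (z - x)‖ ≤ κ * (ε * M + δ) :=
      h1.trans (mul_le_mul_of_nonneg_left h2 hκ0.le)
    calc ‖H (ε • q, z) - x‖ = ‖(z - x) + (H (ε • q, z) - x - (z - x))‖ := by congr 1; abel
      _ ≤ _ := (norm_add_le _ _).trans (add_le_add hz' h4)
  have hwmem : w ∈ Metric.closedBall (H (ε • q, z)) ((a - κ) * (ε * ρ)) := by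
    rw [Metric.mem_closedBall, dist_eq_norm]
    have hw' : ‖w - x‖ ≤ δ := by rw [← dist_eq_norm]; exact (Metric.mem_ball.1 hw).le
    have : ‖w - H (ε • q, z)‖ ≤ ‖w - x‖ + ‖H (ε • q, z) - x‖ := by
      rw [← norm_neg (H (ε • q, z) - x)]
      calc _ = ‖(w - x) + -(H (ε • q, z) - x)‖ := by congr 1; abel
        _ ≤ _ := norm_add_le _ _
    nlinarith [mul_pos hε0 hκ0]
  obtain ⟨p, hp, hpw⟩ := hsurj hwmem
  refine ⟨p, ?_, (hmem p (hball p hp) z hz).2, hpw⟩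
  have : ε⁻¹ • p ∈ C := by
    apply hρC
    rw [Metric.mem_closedBall, dist_eq_norm] at hp ⊢
    have h1 : ε⁻¹ • p - q = ε⁻¹ • (p - ε • q) := by
      rw [smul_sub, smul_smul, inv_mul_cancel₀ hε0.ne', one_smul]
    rw [h1, norm_smul, Real.norm_of_nonneg (by positivity)]
    calc ε⁻¹ * ‖p - ε • q‖ ≤ ε⁻¹ * (ε * ρ) := by gcongr
      _ = ρ := by field_simp
  simpa [smul_smul, hε0.ne'] using hC ε hε0 _ this

/-- A `C¹` vector field has a local flow that is strictly differentiable at time `0`. -/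
theorem exists_local_flow_hasStrictFDerivAt {E : Type*} [NormedAddCommGroup E] [NormedSpace ℝ E]
    [CompleteSpace E] {Y : E → E} {y₀ : E} (hY : ContDiffAt ℝ 1 Y y₀) :
    ∃ ψ : ℝ × E → E,
      HasStrictFDerivAt ψ (ContinuousLinearMap.snd ℝ ℝ E +
        (ContinuousLinearMap.fst ℝ ℝ E).smulRight (Y y₀)) (0, y₀) ∧
      ψ (0, y₀) = y₀ ∧
      ∀ᶠ p in nhds ((0 : ℝ), y₀), ψ (0, p.2) = p.2 ∧
        ∀ t ∈ Icc 0 p.1, HasDerivAt (fun s => ψ (s, p.2)) (Y (ψ (t, p.2))) t := by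
  obtain ⟨ε, hε, a, r, L, K₀, hr, hpl⟩ := IsPicardLindelof.of_contDiffAt_one hY
  obtain ⟨α, hα, L', hL'⟩ :=
    (hpl 0).exists_forall_mem_closedBall_eq_hasDerivWithinAt_lipschitzOnWith
  simp only [zero_sub, zero_add] at hα hL'
  have hIcc : ∀ t, |t| < ε → Icc (-ε) ε ∈ nhds t := fun t ht =>
    Icc_mem_nhds (abs_lt.1 ht).1 (abs_lt.1 ht).2
  have hder : ∀ x ∈ Metric.closedBall y₀ (r : ℝ), ∀ t, |t| < ε →
      HasDerivAt (α x) (Y (α x t)) t := fun x hx t ht =>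
    ((hα x hx).2 t ⟨(abs_lt.1 ht).1.le, (abs_lt.1 ht).2.le⟩).hasDerivAt (hIcc t ht)
  have hr' : (0 : ℝ) < r := hr
  have hcont : ContinuousAt (fun p : E × ℝ => α p.1 p.2) (y₀, 0) := by
    have h := continuousOn_prod_of_continuousOn_lipschitzOnWith (fun p : E × ℝ => α p.1 p.2) L'
      (s := Metric.closedBall y₀ (r : ℝ)) (t := Icc (-ε) ε)
      (fun x hx t ht => ((hα x hx).2 t ht).continuousWithinAt) hL'
    exact h.continuousAt (prod_mem_nhds (Metric.closedBall_mem_nhds _ hr') (hIcc 0 (by simpa)))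
  have hα0 : α y₀ 0 = y₀ := (hα y₀ (Metric.mem_closedBall_self hr'.le)).1
  refine ⟨fun p => α p.2 p.1, ?_, hα0, ?_⟩
  · obtain ⟨K, V, hV, hLip⟩ := hY.exists_lipschitzOnWith
    rw [hasStrictFDerivAt_iff_isLittleO, Asymptotics.isLittleO_iff]
    intro c hc
    have hYc : {y | ‖Y y - Y y₀‖ ≤ c / 2} ∈ nhds y₀ := by
      have := hY.continuousAt.eventually (Metric.closedBall_mem_nhds (Y y₀) (half_pos hc))
      filter_upwards [this] with y hy
      simpa [dist_eq_norm] using hy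
    have hev : ∀ᶠ p in nhds (y₀, (0 : ℝ)), α p.1 p.2 ∈ V ∩ {y | ‖Y y - Y y₀‖ ≤ c / 2} := by
      apply hcont.eventually_mem
      rw [hα0]
      exact Filter.inter_mem hV hYc
    obtain ⟨η, hη, hηs⟩ := Metric.eventually_nhds_iff_ball.1 hev
    set κ : ℝ := c / (2 * (K * L' + 1)) with hκ
    have hκ0 : 0 < κ := by positivity
    have hκc : K * L' * κ ≤ c / 2 := by
      rw [hκ, mul_div_assoc', div_le_div_iff₀ (by positivity) (by positivity)]
      nlinarith [mul_nonneg K.2 L'.2]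
    set θ : ℝ := min (min η κ) (min ε r) with hθ
    have hθ0 : 0 < θ := by positivity
    have hθη : θ ≤ η := (min_le_left _ _).trans (min_le_left _ _)
    have hθκ : θ ≤ κ := (min_le_left _ _).trans (min_le_right _ _)
    have hθε : θ ≤ ε := (min_le_right _ _).trans (min_le_left _ _)
    have hθr : θ ≤ r := (min_le_right _ _).trans (min_le_right _ _)
    have hgood : ∀ x ∈ Metric.ball y₀ θ, ∀ t ∈ Metric.ball (0 : ℝ) θ,
        α x t ∈ V ∧ ‖Y (α x t) - Y y₀‖ ≤ c / 2 := fun x hx t ht =>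
      hηs (x, t) (by
        rw [← ball_prod_same]
        exact ⟨Metric.ball_subset_ball hθη hx, Metric.ball_subset_ball hθη ht⟩)
    have hder' : ∀ x ∈ Metric.ball y₀ θ, ∀ t ∈ Metric.ball (0 : ℝ) θ,
        HasDerivAt (α x) (Y (α x t)) t := fun x hx t ht =>
      hder x (Metric.ball_subset_closedBall (Metric.ball_subset_ball hθr hx)) t
        (by rw [Metric.mem_ball, Real.dist_0_eq_abs] at ht; linarith)
    have hconv := convex_ball (0 : ℝ) θ
    have hnhds : Metric.ball ((0 : ℝ), y₀) θ ×ˢ Metric.ball ((0 : ℝ), y₀) θ ∈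
        nhds (((0 : ℝ), y₀), ((0 : ℝ), y₀)) :=
      prod_mem_nhds (Metric.ball_mem_nhds _ hθ0) (Metric.ball_mem_nhds _ hθ0)
    filter_upwards [hnhds]
    rintro ⟨⟨t, x⟩, ⟨t', x'⟩⟩ ⟨h1, h2⟩
    rw [← ball_prod_same] at h1 h2
    obtain ⟨ht, hx⟩ := h1
    obtain ⟨ht', hx'⟩ := h2
    simp only at ht hx ht' hx' ⊢
    have h0 : (0 : ℝ) ∈ Metric.ball (0 : ℝ) θ := Metric.mem_ball_self hθ0
    have e1 : ‖(α x t - t • Y y₀) - (α x t' - t' • Y y₀)‖ ≤ c / 2 * ‖t - t'‖ := by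
      refine hconv.norm_image_sub_le_of_norm_hasDerivWithin_le
        (f := fun s => α x s - s • Y y₀) (f' := fun s => Y (α x s) - Y y₀) ?_ ?_ ht' ht
      · intro s hs
        have := (hder' x hx s hs).sub ((hasDerivAt_id s).smul_const (Y y₀))
        simpa using! this.hasDerivWithinAt
      · intro s hs
        exact (hgood x hx s hs).2
    have hx0 : ∀ z ∈ Metric.ball y₀ θ, α z 0 = z := fun z hz =>
      (hα z (Metric.ball_subset_closedBall (Metric.ball_subset_ball hθr hz))).1
    have e2 : ‖(α x t' - α x' t') - (x - x')‖ ≤ c / 2 * ‖x - x'‖ := by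
      have : ‖(α x t' - α x' t') - (α x 0 - α x' 0)‖ ≤ (K * L' * ‖x - x'‖) * ‖t' - 0‖ := by
        refine hconv.norm_image_sub_le_of_norm_hasDerivWithin_le
          (f := fun s => α x s - α x' s) (f' := fun s => Y (α x s) - Y (α x' s)) ?_ ?_ h0 ht'
        · intro s hs
          exact ((hder' x hx s hs).sub (hder' x' hx' s hs)).hasDerivWithinAt
        · intro s hs
          have hsε : s ∈ Icc (-ε) ε := by
            rw [Metric.mem_ball, Real.dist_0_eq_abs] at hs
            exact abs_le.1 (by linarith)
          have b1 := hLip.dist_le_mul _ (hgood x hx s hs).1 _ (hgood x' hx' s hs).1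
          have b2 := (hL' s hsε).dist_le_mul _
            (Metric.ball_subset_closedBall (Metric.ball_subset_ball hθr hx)) _
            (Metric.ball_subset_closedBall (Metric.ball_subset_ball hθr hx'))
          rw [dist_eq_norm, dist_eq_norm] at b1 b2
          rw [mul_assoc]
          exact b1.trans (mul_le_mul_of_nonneg_left b2 K.2)
      rw [hx0 x hx, hx0 x' hx', sub_zero] at this
      refine this.trans ?_
      have ht'' : ‖t'‖ ≤ κ := by
        rw [Metric.mem_ball, dist_zero_right] at ht'; linarith
      calc K * L' * ‖x - x'‖ * ‖t'‖ ≤ K * L' * ‖x - x'‖ * κ := by gcongr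
        _ = K * L' * κ * ‖x - x'‖ := by ring
        _ ≤ _ := by gcongr
    have n1 : ‖t - t'‖ ≤ ‖((t, x) : ℝ × E) - (t', x')‖ := by simp
    have n2 : ‖x - x'‖ ≤ ‖((t, x) : ℝ × E) - (t', x')‖ := by simp
    calc _ = ‖((α x t - t • Y y₀) - (α x t' - t' • Y y₀)) +
          ((α x t' - α x' t') - (x - x'))‖ := by
            congr 1
            simp [sub_smul]
            abel
      _ ≤ c / 2 * ‖t - t'‖ + c / 2 * ‖x - x'‖ := (norm_add_le _ _).trans (add_le_add e1 e2)
      _ ≤ c / 2 * ‖((t, x) : ℝ × E) - (t', x')‖ + c / 2 * ‖((t, x) : ℝ × E) - (t', x')‖ := by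
            gcongr
      _ = _ := by ring
  · have hnhds : Iio ε ×ˢ Metric.closedBall y₀ (r : ℝ) ∈ nhds ((0 : ℝ), y₀) :=
      prod_mem_nhds (Iio_mem_nhds hε) (Metric.closedBall_mem_nhds _ hr')
    filter_upwards [hnhds]
    rintro ⟨c, y⟩ ⟨hc, hy⟩
    refine ⟨(hα y hy).1, fun t ht => hder y hy t ?_⟩
    rw [abs_of_nonneg ht.1]
    exact ht.2.trans_lt hc

/-- The accessible set is closed under concatenation of trajectories. -/
theorem access_trans {d m : ℕ} {X0 : Ed d → Ed d} {X : Fin m → Ed d → Ed d}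
    {U : Set (Fin m → ℝ)} {t₁ t₂ : ℝ} (ht₁ : 0 ≤ t₁) (ht₂ : 0 ≤ t₂) {z w v : Ed d}
    (h₁ : w ∈ Access X0 X U t₁ z) (h₂ : v ∈ Access X0 X U t₂ w) :
    v ∈ Access X0 X U (t₁ + t₂) z := by
  obtain ⟨x₁, u₁, ⟨hm₁, hU₁, ⟨C₁, hC₁⟩, hi₁, hs₁⟩, hz, hw⟩ := h₁
  obtain ⟨x₂, u₂, ⟨hm₂, hU₂, ⟨C₂, hC₂⟩, hi₂, hs₂⟩, hw', hv⟩ := h₂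
  set x : ℝ → Ed d := fun t => if t ≤ t₁ then x₁ t else x₂ (t - t₁) with hx
  set u : ℝ → Fin m → ℝ := fun t => if t ≤ t₁ then u₁ t else u₂ (t - t₁) with hu
  set g₁ : ℝ → Ed d := fun s => X0 (x₁ s) + ∑ k, u₁ s k • X k (x₁ s) with hg₁
  set g₂ : ℝ → Ed d := fun s => X0 (x₂ s) + ∑ k, u₂ s k • X k (x₂ s) with hg₂
  set g : ℝ → Ed d := fun s => X0 (x s) + ∑ k, u s k • X k (x s) with hg
  have hgle : ∀ s, s ≤ t₁ → g s = g₁ s := fun s hs => by simp [hg, hg₁, hx, hu, hs]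
  have hggt : ∀ s, t₁ < s → g s = g₂ (s - t₁) := fun s hs => by
    simp [hg, hg₂, hx, hu, not_le.2 hs]
  have hx0 : x 0 = x₁ 0 := by simp [hx, ht₁]
  have hint₁ : IntervalIntegrable g volume 0 t₁ := by
    refine hi₁.congr fun s hs => ?_
    rw [uIoc_of_le ht₁] at hs
    exact (hgle s hs.2).symm
  have hint₂ : IntervalIntegrable g volume t₁ (t₁ + t₂) := by
    have := hi₂.comp_sub_right t₁
    rw [zero_add, add_comm t₂] at this
    refine this.congr fun s hs => ?_
    rw [uIoc_of_le (by linarith)] at hs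
    exact (hggt s hs.1).symm
  refine ⟨x, u, ⟨?_, ?_, ⟨max C₁ C₂, ?_⟩, hint₁.trans hint₂, ?_⟩, hx0.trans hz, ?_⟩
  · exact Measurable.ite measurableSet_Iic hm₁ (hm₂.comp (measurable_id.sub_const t₁))
  · intro t ht
    by_cases h : t ≤ t₁
    · simpa [hu, h] using hU₁ t ⟨ht.1, h⟩
    · simpa [hu, h] using hU₂ (t - t₁) ⟨by linarith [not_le.1 h], by linarith [ht.2]⟩
  · intro t ht
    by_cases h : t ≤ t₁
    · simpa [hu, h] using Or.inl (hC₁ t ⟨ht.1, h⟩)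
    · simpa [hu, h] using Or.inr (hC₂ (t - t₁) ⟨by linarith [not_le.1 h], by linarith [ht.2]⟩)
  · have key : ∀ t ∈ Icc 0 t₁, ∫ s in (0:ℝ)..t, g s = ∫ s in (0:ℝ)..t, g₁ s := by
      intro t ht
      refine intervalIntegral.integral_congr fun s hs => hgle s ?_
      rw [uIcc_of_le ht.1] at hs
      exact hs.2.trans ht.2
    intro t ht
    by_cases h : t ≤ t₁
    · rw [key t ⟨ht.1, h⟩, hx0, ← hs₁ t ⟨ht.1, h⟩]
      simp [hx, h]
    · have h' := not_le.1 h
      have hsub : t - t₁ ∈ Icc 0 t₂ := ⟨by linarith, by linarith [ht.2]⟩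
      have hI : ∫ s in t₁..t, g s = ∫ s in (0:ℝ)..(t - t₁), g₂ s := by
        have e : ∫ s in t₁..t, g s = ∫ s in t₁..t, g₂ (s - t₁) := by
          refine intervalIntegral.integral_congr_ae (Filter.Eventually.of_forall fun s hs => ?_)
          rw [uIoc_of_le h'.le] at hs
          exact hggt s hs.1
        rw [e, intervalIntegral.integral_comp_sub_right g₂ t₁, sub_self]
      have hint : IntervalIntegrable g volume t₁ t := hint₂.mono_set (by
        rw [uIcc_of_le h'.le, uIcc_of_le (by linarith)]
        exact Icc_subset_Icc_right ht.2)
      rw [← intervalIntegral.integral_add_adjacent_intervals hint₁ hint,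
        key t₁ ⟨ht₁, le_rfl⟩, hI, ← add_assoc, hx0, ← hs₁ t₁ ⟨ht₁, le_rfl⟩, hw, ← hw',
        ← hs₂ _ hsub]
      simp [hx, h]
  · by_cases h : t₁ + t₂ ≤ t₁
    · have h0 : t₂ = 0 := by linarith
      subst h0
      simp [hx, hw, ← hw', hv]
    · simp [hx, h, hv]

/-- The accessibility relation of the control system. -/
def Reaches {d m : ℕ} (X0 : Ed d → Ed d) (X : Fin m → Ed d → Ed d) (U : Set (Fin m → ℝ))
    (z w : Ed d) : Prop :=
  ∃ t, 0 ≤ t ∧ w ∈ Access X0 X U t z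

theorem Reaches.trans {d m : ℕ} {X0 : Ed d → Ed d} {X : Fin m → Ed d → Ed d}
    {U : Set (Fin m → ℝ)} {z w v : Ed d} (h₁ : Reaches X0 X U z w) (h₂ : Reaches X0 X U w v) :
    Reaches X0 X U z v := by
  obtain ⟨t₁, ht₁, h₁⟩ := h₁
  obtain ⟨t₂, ht₂, h₂⟩ := h₂
  exact ⟨t₁ + t₂, by positivity, access_trans ht₁ ht₂ h₁ h₂⟩

/-- Integral curves of the vector field obtained with a constant control are trajectories. -/
theorem reaches_of_hasDerivAt {d m : ℕ} {X0 : Ed d → Ed d} {X : Fin m → Ed d → Ed d}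
    {U : Set (Fin m → ℝ)} (hX0 : Continuous X0) (hX : ∀ k, Continuous (X k))
    {u : Fin m → ℝ} (hu : u ∈ U) {γ : ℝ → Ed d} {c : ℝ} (hc : 0 ≤ c)
    (hγ : ∀ t ∈ Icc 0 c, HasDerivAt γ (X0 (γ t) + ∑ k, u k • X k (γ t)) t) :
    Reaches X0 X U (γ 0) (γ c) := by
  have hcont : ContinuousOn (fun s => X0 (γ s) + ∑ k, u k • X k (γ s)) (Icc 0 c) := by
    have hγc : ContinuousOn γ (Icc 0 c) := fun t ht => (hγ t ht).continuousAt.continuousWithinAt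
    have hY : Continuous (fun y => X0 y + ∑ k, u k • X k y) := by fun_prop
    exact hY.comp_continuousOn hγc
  have hint : ∀ t ∈ Icc 0 c,
      IntervalIntegrable (fun s => X0 (γ s) + ∑ k, u k • X k (γ s)) volume 0 t := by
    intro t ht
    refine ContinuousOn.intervalIntegrable ?_
    rw [uIcc_of_le ht.1]
    exact hcont.mono (Icc_subset_Icc_right ht.2)
  refine ⟨c, hc, γ, fun _ => u, ⟨measurable_const, fun _ _ => hu, ⟨‖u‖, fun _ _ => le_rfl⟩,
    hint c ⟨hc, le_rfl⟩, fun t ht => ?_⟩, rfl, rfl⟩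
  rw [intervalIntegral.integral_eq_sub_of_hasDerivAt (f := γ) _ (hint t ht)]
  · abel
  · intro s hs
    rw [uIcc_of_le ht.1] at hs
    exact hγ s ⟨hs.1, hs.2.trans ht.2⟩

/-- If conic combinations of `S` together with a line exhaust a finite-dimensional space, then so do
conic combinations of a suitable finite family in `S`. -/
theorem exists_finite_family_of_coneHull_add_line {d : ℕ} {S : Set (Ed d)} {e : Ed d}
    (h : {y : Ed d | ∃ c ∈ coneHull S, ∃ lam : ℝ, y = c + lam • e} = univ) :
    ∃ (ι : Type) (_ : Fintype ι) (v : ι → Ed d), (∀ i, v i ∈ S) ∧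
      ∀ y : Ed d, ∃ (b : ι → ℝ) (lam : ℝ), (∀ i, 0 ≤ b i) ∧
        y = ∑ i, b i • v i + lam • e := by
  let f : Fin d × Bool → Ed d := fun p =>
    (if p.2 then (1 : ℝ) else -1) • EuclideanSpace.single p.1 (1 : ℝ)
  have hf : ∀ p, ∃ c ∈ coneHull S, ∃ lam : ℝ, f p = c + lam • e := fun p => by
    have : f p ∈ {y : Ed d | ∃ c ∈ coneHull S, ∃ lam : ℝ, y = c + lam • e} := h ▸ mem_univ _
    exact this
  choose c hc lam hlam using hf
  choose n v b hv hb hsum using hc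
  refine ⟨Σ p, Fin (n p), inferInstance, fun i => v i.1 i.2, fun i => hv _ _, fun y => ?_⟩
  let a : Fin d × Bool → ℝ := fun p => if p.2 then max (y p.1) 0 else max (-y p.1) 0
  have ha : ∀ p, 0 ≤ a p := fun p => by
    dsimp only [a]; split_ifs <;> exact le_max_right _ _
  refine ⟨fun i => a i.1 * b i.1 i.2, ∑ p, a p * lam p, fun i => mul_nonneg (ha _) (hb _ _), ?_⟩
  have hy : y = ∑ p, a p • f p := by
    rw [Fintype.sum_prod_type]
    ext j
    simp only [a, f, Fintype.sum_bool, PiLp.add_apply, WithLp.ofLp_sum, Finset.sum_apply,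
      PiLp.smul_apply, PiLp.single_apply, if_true, smul_eq_mul, Bool.false_eq_true, if_false]
    rw [Finset.sum_eq_single j]
    · rcases le_total 0 (y j) with h0 | h0 <;> simp [h0]
    · intro k _ hk
      simp [hk.symm]
    · simp
  calc y = ∑ p, a p • f p := hy
    _ = ∑ p, (∑ i, (a p * b p i) • v p i + (a p * lam p) • e) := by
        refine Finset.sum_congr rfl fun p _ => ?_
        rw [hlam p, hsum p, smul_add, Finset.smul_sum, smul_smul]
        simp only [smul_smul]
    _ = _ := by rw [Finset.sum_add_distrib, Fintype.sum_sigma, Finset.sum_smul]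

section Flow

variable {d : ℕ} {φ : ℝ → Ed d → Ed d} {X0 : Ed d → Ed d}

theorem flow_hasStrictFDerivAt
    (hφsmooth : ContDiff ℝ (⊤ : ℕ∞) (fun p : ℝ × Ed d => φ p.1 p.2)) (t : ℝ) (x : Ed d) :
    HasStrictFDerivAt (φ t) (fderiv ℝ (φ t) x) x := by
  have h : ContDiff ℝ (⊤ : ℕ∞) (φ t) := hφsmooth.comp (contDiff_const.prodMk contDiff_id)
  exact h.contDiffAt.hasStrictFDerivAt (by simp)

theorem flow_neg_apply (hφ0 : ∀ x, φ 0 x = x) (hφadd : ∀ s t x, φ (s + t) x = φ s (φ t x))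
    (t : ℝ) (x : Ed d) : φ (-t) (φ t x) = x := by
  rw [← hφadd, neg_add_cancel, hφ0]

theorem fderiv_flow_neg_comp
    (hφsmooth : ContDiff ℝ (⊤ : ℕ∞) (fun p : ℝ × Ed d => φ p.1 p.2))
    (hφ0 : ∀ x, φ 0 x = x) (hφadd : ∀ s t x, φ (s + t) x = φ s (φ t x)) (t : ℝ) (x w : Ed d) :
    fderiv ℝ (φ (-t)) (φ t x) (fderiv ℝ (φ t) x w) = w := by
  have h := ((flow_hasStrictFDerivAt hφsmooth (-t) (φ t x)).comp x
    (flow_hasStrictFDerivAt hφsmooth t x)).hasFDerivAt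
  have he : φ (-t) ∘ φ t = id := funext fun y => flow_neg_apply hφ0 hφadd t y
  have h : HasFDerivAt (φ (-t) ∘ φ t) _ x := h
  rw [he] at h
  have := h.unique (hasFDerivAt_id x)
  exact congrArg (fun A : Ed d →L[ℝ] Ed d => A w) this

/-- The drift is invariant under its own flow. -/
theorem pushf_drift
    (hφsmooth : ContDiff ℝ (⊤ : ℕ∞) (fun p : ℝ × Ed d => φ p.1 p.2))
    (hφ0 : ∀ x, φ 0 x = x) (hφadd : ∀ s t x, φ (s + t) x = φ s (φ t x))
    (hφder : ∀ t x, HasDerivAt (fun τ => φ τ x) (X0 (φ t x)) t) (t : ℝ) (x : Ed d) :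
    pushf φ X0 t x = X0 x := by
  have h1 := (flow_hasStrictFDerivAt hφsmooth (-t) (φ t x)).hasFDerivAt.comp_hasDerivAt t
    (hφder t x)
  have h2 : HasDerivAt (fun τ => φ (τ - t) x) (X0 x) t := by
    have := (hφder 0 x)
    rw [hφ0, ← sub_self t] at this
    exact this.comp_sub_const t t
  refine h1.unique (h2.congr_of_eventuallyEq (Filter.Eventually.of_forall fun τ => ?_))
  simp only [Function.comp_apply]
  rw [← hφadd, neg_add_eq_sub]

theorem uncurry_flow_hasStrictFDerivAt
    (hφsmooth : ContDiff ℝ (⊤ : ℕ∞) (fun p : ℝ × Ed d => φ p.1 p.2))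
    (hφ0 : ∀ x, φ 0 x = x)
    (hφder : ∀ t x, HasDerivAt (fun τ => φ τ x) (X0 (φ t x)) t) (x : Ed d) :
    HasStrictFDerivAt (fun p : ℝ × Ed d => φ p.1 p.2)
      (ContinuousLinearMap.snd ℝ ℝ (Ed d) +
        (ContinuousLinearMap.fst ℝ ℝ (Ed d)).smulRight (X0 x)) (0, x) := by
  have h : HasStrictFDerivAt (fun p : ℝ × Ed d => φ p.1 p.2) _ (0, x) :=
    hφsmooth.contDiffAt.hasStrictFDerivAt (by simp)
  have h1 : HasFDerivAt (φ 0) _ x := h.hasFDerivAt.comp x (hasFDerivAt_prodMk_right (0 : ℝ) x)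
  have h0 : φ 0 = id := funext hφ0
  rw [h0] at h1
  have e1 := (hasFDerivAt_id x).unique h1
  have h2 : HasFDerivAt (fun τ => φ τ x) _ 0 :=
    HasFDerivAt.comp (0 : ℝ) (g := fun p : ℝ × Ed d => φ p.1 p.2) (f := fun t : ℝ => (t, x))
      h.hasFDerivAt (hasFDerivAt_prodMk_left (0 : ℝ) x)
  have e2 := (hφder 0 x).unique h2.hasDerivAt
  rw [hφ0] at e2
  refine h.congr_fderiv (ContinuousLinearMap.ext fun p => ?_)
  obtain ⟨t, w⟩ := p
  have e1' := congrArg (fun A : Ed d →L[ℝ] Ed d => A w) e1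
  simp only [ContinuousLinearMap.id_apply, ContinuousLinearMap.comp_apply,
    ContinuousLinearMap.inr_apply, ContinuousLinearMap.inl_apply] at e1' e2
  have e3 : ((t, w) : ℝ × Ed d) = (0, w) + t • (1, 0) := by simp
  rw [e3, map_add, map_add, map_smul, map_smul, ← e1', ← e2]
  simp

theorem pushf_add_sum {m : ℕ} (X : Fin m → Ed d → Ed d) (u : Fin m → ℝ) (τ : ℝ) (x : Ed d) :
    pushf φ X0 τ x + ∑ k, u k • pushf φ (X k) τ x =
      pushf φ (fun y => X0 y + ∑ k, u k • X k y) τ x := by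
  simp [pushf, map_add, map_sum]

end Flow

section NeedleVariation

variable {d m : ℕ} {φ : ℝ → Ed d → Ed d} {X0 : Ed d → Ed d} {X : Fin m → Ed d → Ed d}
  {U : Set (Fin m → ℝ)}

theorem reaches_flow (hX0 : Continuous X0) (hX : ∀ k, Continuous (X k)) (hU0 : (0 : Fin m → ℝ) ∈ U)
    (hφ0 : ∀ x, φ 0 x = x) (hφder : ∀ t x, HasDerivAt (fun τ => φ τ x) (X0 (φ t x)) t)
    {σ : ℝ} (hσ : 0 ≤ σ) (x : Ed d) : Reaches X0 X U x (φ σ x) := by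
  have := reaches_of_hasDerivAt (X := X) hX0 hX hU0 hσ (γ := fun τ => φ τ x)
    (fun t _ => by simpa using hφder t x)
  rwa [hφ0] at this

/-- Superposing needle variations, with control `u i` at time `τ i` during a time `c i`, gives
accessible points depending strictly differentiably on the durations and on the initial point; they
are expressed here after transport back to time `0` along the drift. -/
theorem exists_needle_variation
    (hX0 : ContDiff ℝ (⊤ : ℕ∞) X0) (hX : ∀ k, ContDiff ℝ (⊤ : ℕ∞) (X k))
    (hU0 : (0 : Fin m → ℝ) ∈ U)
    (hφsmooth : ContDiff ℝ (⊤ : ℕ∞) (fun p : ℝ × Ed d => φ p.1 p.2))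
    (hφ0 : ∀ x, φ 0 x = x)
    (hφadd : ∀ s t x, φ (s + t) x = φ s (φ t x))
    (hφder : ∀ t x, HasDerivAt (fun τ => φ τ x) (X0 (φ t x)) t)
    {ι : Type*} [Fintype ι] {τ : ι → ℝ} (hτ : ∀ i, 0 ≤ τ i) {u : ι → Fin m → ℝ}
    (hu : ∀ i, u i ∈ U) (x : Ed d) (s : Finset ι) :
    ∃ G : (ι → ℝ) × Ed d → Ed d,
      HasStrictFDerivAt G (ContinuousLinearMap.snd ℝ (ι → ℝ) (Ed d) +
        ∑ i ∈ s, ((ContinuousLinearMap.proj (R := ℝ) (φ := fun _ : ι => ℝ) i).comp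
          (ContinuousLinearMap.fst ℝ (ι → ℝ) (Ed d))).smulRight
            (X0 x + ∑ k, u i k • pushf φ (X k) (τ i) x)) (0, x) ∧
      G (0, x) = x ∧
      ∀ᶠ p in nhds ((0 : ι → ℝ), x), (∀ i, 0 ≤ p.1 i) → ∀ σ, 0 ≤ σ → (∀ i ∈ s, τ i ≤ σ) →
        Reaches X0 X U p.2 (φ σ (G p)) := by
  classical
  have hreach : ∀ {σ : ℝ}, 0 ≤ σ → ∀ y, Reaches X0 X U y (φ σ y) := fun hσ y =>
    reaches_flow hX0.continuous (fun k => (hX k).continuous) hU0 hφ0 hφder hσ y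
  induction s using Finset.induction_on_max_value τ with
  | empty =>
    refine ⟨Prod.snd, ?_, rfl, Filter.Eventually.of_forall fun p _ σ hσ _ => hreach hσ _⟩
    simpa using hasStrictFDerivAt_snd (𝕜 := ℝ) (p := ((0 : ι → ℝ), x))
  | insert a s has hmax ih =>
    obtain ⟨G, hG, hGx, hGr⟩ := ih
    set Y : Ed d → Ed d := fun y => X0 y + ∑ k, u a k • X k y with hY
    have hYc : ContDiff ℝ (⊤ : ℕ∞) Y :=
      hX0.add (ContDiff.sum fun k _ => (hX k).const_smul (u a k))
    obtain ⟨ψ, hψ, hψ0, hψr⟩ := exists_local_flow_hasStrictFDerivAt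
      (y₀ := φ (τ a) x) (hYc.contDiffAt.of_le (by exact_mod_cast le_top))
    have hψreach : ∀ᶠ p in nhds ((0 : ℝ), φ (τ a) x), 0 ≤ p.1 → Reaches X0 X U p.2 (ψ p) := by
      filter_upwards [hψr] with p hp hp0
      have := reaches_of_hasDerivAt (X := X) hX0.continuous (fun k => (hX k).continuous) (hu a) hp0
        (γ := fun s => ψ (s, p.2)) hp.2
      rwa [hp.1] at this
    have hφG : HasStrictFDerivAt (fun p => φ (τ a) (G p)) _ ((0 : ι → ℝ), x) :=
      HasStrictFDerivAt.comp _ (g := φ (τ a)) (by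
        rw [hGx]; exact flow_hasStrictFDerivAt hφsmooth (τ a) x) hG
    have hpa : HasStrictFDerivAt (fun p : (ι → ℝ) × Ed d => p.1 a)
        ((ContinuousLinearMap.proj (R := ℝ) (φ := fun _ : ι => ℝ) a).comp
          (ContinuousLinearMap.fst ℝ (ι → ℝ) (Ed d))) (0, x) :=
      ((ContinuousLinearMap.proj (R := ℝ) (φ := fun _ : ι => ℝ) a).comp
        (ContinuousLinearMap.fst ℝ (ι → ℝ) (Ed d))).hasStrictFDerivAt
    have hpair := hpa.prodMk hφG
    have hpt : ((((0 : ι → ℝ), x).1 a : ℝ), φ (τ a) (G (0, x))) = (0, φ (τ a) x) := by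
      simp [hGx]
    have hψG : HasStrictFDerivAt (fun p => ψ (p.1 a, φ (τ a) (G p))) _ ((0 : ι → ℝ), x) :=
      HasStrictFDerivAt.comp _ (g := ψ) (by rw [hpt]; exact hψ) hpair
    refine ⟨fun p => φ (-τ a) (ψ (p.1 a, φ (τ a) (G p))), ?_, ?_, ?_⟩
    · have hfin := HasStrictFDerivAt.comp ((0 : ι → ℝ), x) (g := φ (-τ a)) (by
        rw [hpt, hψ0]; exact flow_hasStrictFDerivAt hφsmooth (-τ a) (φ (τ a) x)) hψG
      refine hfin.congr_fderiv (ContinuousLinearMap.ext fun p => ?_)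
      have e1 := fderiv_flow_neg_comp hφsmooth hφ0 hφadd (τ a) x
      have e2 : fderiv ℝ (φ (-τ a)) (φ (τ a) x) (Y (φ (τ a) x)) =
          X0 x + ∑ k, u a k • pushf φ (X k) (τ a) x := by
        rw [← pushf_drift hφsmooth hφ0 hφadd hφder (τ a) x, pushf_add_sum]
        rfl
      rw [Finset.sum_insert has]
      simp only [ContinuousLinearMap.comp_apply, add_apply,
        ContinuousLinearMap.smulRight_apply, ContinuousLinearMap.prod_apply,
        ContinuousLinearMap.coe_fst', ContinuousLinearMap.coe_snd',
        ContinuousLinearMap.proj_apply, map_add, map_smul, e1, e2]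
      abel
    · show φ (-τ a) (ψ (((0 : ι → ℝ), x).1 a, φ (τ a) (G (0, x)))) = x
      rw [hpt, hψ0, flow_neg_apply hφ0 hφadd]
    · have hev := hpair.continuousAt.eventually (p := fun p => 0 ≤ p.1 → Reaches X0 X U p.2 (ψ p))
        (by beta_reduce; rw [hpt]; exact hψreach)
      filter_upwards [hGr, hev] with p hp1 hp2 hp0 σ hσ hσi
      have hσa : τ a ≤ σ := hσi a (Finset.mem_insert_self _ _)
      have r1 := hp1 hp0 (τ a) (hτ a) hmax
      have r2 := hp2 (hp0 a)
      have r3 := hreach (sub_nonneg.2 hσa) (ψ (p.1 a, φ (τ a) (G p)))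
      rw [sub_eq_add_neg, hφadd] at r3
      exact (r1.trans r2).trans r3

end NeedleVariation

/-- Near any point, all points are accessible from one another. -/
theorem eventually_reaches
    {d m : ℕ} {X0 : Ed d → Ed d} {X : Fin m → Ed d → Ed d} {U : Set (Fin m → ℝ)}
    (hX0 : ContDiff ℝ (⊤ : ℕ∞) X0) (hX : ∀ k, ContDiff ℝ (⊤ : ℕ∞) (X k))
    (hU0 : (0 : Fin m → ℝ) ∈ U) {φ : ℝ → Ed d → Ed d}
    (hφsmooth : ContDiff ℝ (⊤ : ℕ∞) (fun p : ℝ × Ed d => φ p.1 p.2))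
    (hφ0 : ∀ x, φ 0 x = x)
    (hφadd : ∀ s t x, φ (s + t) x = φ s (φ t x))
    (hφder : ∀ t x, HasDerivAt (fun τ => φ τ x) (X0 (φ t x)) t)
    {x : Ed d} {T : ℝ} (hT0 : 0 < T) (hTx : φ T x = x)
    (hcone : {y : Ed d | ∃ c ∈ coneHull (EIcc φ X U 0 T x), ∃ lam : ℝ, y = c + lam • X0 x}
        = univ) :
    ∀ᶠ r in nhds (x, x), Reaches X0 X U r.1 r.2 := by
  obtain ⟨ι, _, v, hv, hspan⟩ := exists_finite_family_of_coneHull_add_line hcone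
  have hv' : ∀ i, ∃ τ ∈ Icc 0 T, ∃ u ∈ U, v i = ∑ k, u k • pushf φ (X k) τ x := fun i => by
    simpa only [EIcc, EsetAt, mem_iUnion, exists_prop, mem_ofPred_eq] using hv i
  choose τ hτ u hu hvu using hv'
  obtain ⟨G, hG, hGx, hGr⟩ := exists_needle_variation hX0 hX hU0 hφsmooth hφ0 hφadd hφder
    (fun i => (hτ i).1) hu x Finset.univ
  simp only [← hvu] at hG
  let B : (ι → ℝ) × ℝ →L[ℝ] Ed d :=
    ∑ i, ((ContinuousLinearMap.proj (R := ℝ) (φ := fun _ : ι => ℝ) i).comp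
      (ContinuousLinearMap.fst ℝ (ι → ℝ) ℝ)).smulRight (X0 x + v i) +
      (ContinuousLinearMap.snd ℝ (ι → ℝ) ℝ).smulRight (X0 x)
  have hBapp : ∀ p : (ι → ℝ) × ℝ, B p = ∑ i, p.1 i • (X0 x + v i) + p.2 • X0 x := fun p => by
    simp [B]
  have hsolve : ∀ y : Ed d, ∃ p : (ι → ℝ) × ℝ, (∀ i, 0 ≤ p.1 i) ∧ B p = y := fun y => by
    obtain ⟨b, lam, hb, hy⟩ := hspan y
    refine ⟨(b, lam - ∑ i, b i), hb, ?_⟩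
    rw [hBapp, hy]
    simp only [smul_add, Finset.sum_add_distrib, sub_smul, Finset.sum_smul]
    abel
  obtain ⟨p₀, hp₀, hBp₀⟩ := hsolve (-B (1, 0))
  let q : (ι → ℝ) × ℝ := p₀ + (1, 0)
  have hq : B q = 0 := by
    show B (p₀ + (1, 0)) = 0
    rw [map_add, hBp₀, neg_add_cancel]
  let C : Set ((ι → ℝ) × ℝ) := {p | ∀ i, 0 ≤ p.1 i}
  have hqC : C ∈ nhds q := by
    have : ∀ᶠ p : (ι → ℝ) × ℝ in nhds q, ∀ i, 0 < p.1 i := by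
      refine Filter.eventually_all.2 fun i => ?_
      have hc : Continuous fun p : (ι → ℝ) × ℝ => p.1 i := by fun_prop
      refine hc.continuousAt.eventually (lt_mem_nhds ?_)
      show (0 : ℝ) < p₀.1 i + 1
      linarith [hp₀ i]
    exact this.mono fun p hp i => (hp i).le
  let K : ((ι → ℝ) × ℝ) × Ed d → Ed d := fun p => φ p.1.2 (G (p.1.1, p.2))
  have hGK : HasStrictFDerivAt (fun p : ((ι → ℝ) × ℝ) × Ed d => G (p.1.1, p.2)) _ ((0 : (ι → ℝ) × ℝ), x) :=
    HasStrictFDerivAt.comp ((0 : (ι → ℝ) × ℝ), x) (g := G) hG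
      (((ContinuousLinearMap.fst ℝ (ι → ℝ) ℝ).comp
        (ContinuousLinearMap.fst ℝ ((ι → ℝ) × ℝ) (Ed d))).prod
          (ContinuousLinearMap.snd ℝ ((ι → ℝ) × ℝ) (Ed d))).hasStrictFDerivAt
  have hs : HasStrictFDerivAt (fun p : ((ι → ℝ) × ℝ) × Ed d => p.1.2)
      ((ContinuousLinearMap.snd ℝ (ι → ℝ) ℝ).comp (ContinuousLinearMap.fst ℝ ((ι → ℝ) × ℝ) (Ed d)))
        ((0 : (ι → ℝ) × ℝ), x) :=
          ((ContinuousLinearMap.snd ℝ (ι → ℝ) ℝ).comp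
            (ContinuousLinearMap.fst ℝ ((ι → ℝ) × ℝ) (Ed d))).hasStrictFDerivAt
  have hK : HasStrictFDerivAt K (B.comp (ContinuousLinearMap.fst ℝ ((ι → ℝ) × ℝ) (Ed d)) +
      ContinuousLinearMap.snd ℝ ((ι → ℝ) × ℝ) (Ed d)) (0, x) := by
    have h := HasStrictFDerivAt.comp ((0 : (ι → ℝ) × ℝ), x) (g := fun p : ℝ × Ed d => φ p.1 p.2) (by
      show HasStrictFDerivAt _ _ ((0 : ℝ), G (0, x))
      rw [hGx]
      exact uncurry_flow_hasStrictFDerivAt hφsmooth hφ0 hφder x) (hs.prodMk hGK)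
    refine h.congr_fderiv (ContinuousLinearMap.ext fun p => ?_)
    simp [B]
    abel
  have hKx : K (0, x) = x := by
    show φ 0 (G (0, x)) = x
    rw [hφ0, hGx]
  have hN : {p : ((ι → ℝ) × ℝ) × Ed d | p.1 ∈ C → Reaches X0 X U p.2 (φ (2 * T) (K p))} ∈
      nhds ((0 : (ι → ℝ) × ℝ), x) := by
    have hc : Continuous fun p : ((ι → ℝ) × ℝ) × Ed d => (p.1.1, p.2) := by fun_prop
    have h1 := (hc.continuousAt (x := ((0 : (ι → ℝ) × ℝ), x))).eventually hGr
    have hc2 : Continuous fun p : ((ι → ℝ) × ℝ) × Ed d => p.1.2 := by fun_prop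
    have h2 := (hc2.continuousAt (x := ((0 : (ι → ℝ) × ℝ), x))).eventually (lt_mem_nhds (neg_lt_zero.2 hT0))
    filter_upwards [h1, h2] with p hp1 hp2 hpC
    have := hp1 hpC (2 * T + p.1.2) (by linarith) fun i _ => by linarith [(hτ i).2]
    rwa [hφadd] at this
  have hmain := eventually_exists_mem_cone_eq hK hKx
    (fun y => (hsolve y).imp fun p hp => hp.2) hq
    (C := C)
    (fun ε hε p hp i => mul_nonneg hε.le (hp i)) hqC hN
  have h2T : φ (2 * T) x = x := by rw [two_mul, hφadd, hTx, hTx]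
  have hneg : φ (-(2 * T)) x = x := by
    nth_rw 1 [← h2T]
    exact flow_neg_apply hφ0 hφadd _ _
  have hφc : Continuous fun r : Ed d × Ed d => (r.1, φ (-(2 * T)) r.2) := by
    have : Continuous (fun r : Ed d × Ed d => φ (-(2 * T)) r.2) :=
      hφsmooth.continuous.comp (continuous_const.prodMk continuous_snd)
    exact continuous_fst.prodMk this
  have := (hφc.continuousAt (x := (x, x))).eventually (by simpa only [hneg] using hmain)
  filter_upwards [this] with r hr
  obtain ⟨p, hpC, hpN, hpK⟩ := hr
  have := hpN hpC
  rw [hpK, ← hφadd, add_neg_cancel, hφ0] at this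
  exact this

/-- Theorem 3.1: global controllability under a periodic drift, assuming that for every `x`
the conic hull of `E^U(x)`, together with the line `ℝ·X⁰(x)`, spans all of `ℝ^d`. -/
theorem global_controllability_of_cone_condition
    {d m : ℕ}
    (X0 : Ed d → Ed d) (X : Fin m → Ed d → Ed d) (U : Set (Fin m → ℝ))
    (hX0 : ContDiff ℝ (⊤ : ℕ∞) X0) (hX : ∀ k, ContDiff ℝ (⊤ : ℕ∞) (X k))
    (hU0 : (0 : Fin m → ℝ) ∈ U) (hUspan : Submodule.span ℝ U = ⊤)
    (φ : ℝ → Ed d → Ed d)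
    (hφsmooth : ContDiff ℝ (⊤ : ℕ∞) (fun p : ℝ × Ed d => φ p.1 p.2))
    (hφ0 : ∀ x, φ 0 x = x)
    (hφadd : ∀ s t x, φ (s + t) x = φ s (φ t x))
    (hφder : ∀ t x, HasDerivAt (fun τ => φ τ x) (X0 (φ t x)) t)
    (T : Ed d → ℝ)
    (hT : ∀ x, 0 < T x ∧ φ (T x) x = x ∧ ∀ t, 0 < t → φ t x = x → T x ≤ t)
    (hneq : ∀ x, X0 x ≠ 0)
    (hcone : ∀ x : Ed d,
      {y : Ed d | ∃ c ∈ coneHull (EIcc φ X U 0 (T x) x), ∃ lam : ℝ, y = c + lam • X0 x}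
        = univ) :
    ∀ x : Ed d, (⋃ t ∈ Ici (0:ℝ), Access X0 X U t x) = univ := by

  intro x
  have hloc : ∀ z, ∀ᶠ y in nhds z, Reaches X0 X U z y ∧ Reaches X0 X U y z := by
    intro z
    have h := eventually_reaches hX0 hX hU0 hφsmooth hφ0 hφadd hφder (hT z).1 (hT z).2.1 (hcone z)
    have h1 : Continuous fun y : Ed d => (z, y) := by fun_prop
    have h2 : Continuous fun y : Ed d => (y, z) := by fun_prop
    exact (h1.continuousAt (x := z) |>.eventually h).and (h2.continuousAt (x := z) |>.eventually h)
  refine eq_univ_of_forall fun y => ?_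
  obtain ⟨t, ht, hy⟩ := PreconnectedSpace.induction₂' (Reaches X0 X U) hloc
    ⟨fun _ _ _ => Reaches.trans⟩ x y
  exact mem_iUnion₂.2 ⟨t, ht, hy⟩
end
end

section
/- (Theorem 3.5, part I: local controllability along a drift trajectory.) Let U ⊆ ℝ^m be convex, compact, with 0 ∈ U. Let t_f > 0, let x̄(t) = φ⁰(t, x̄₀) for t ∈ [0,t_f] be the drift solution starting at x̄₀ ∈ ℝ^d, and set Ē = E^U_{[0,t_f]}(x̄₀). If cone Ē = ℝ^d, then for every ε > 0 the accessible set A^{εU}_{t_f}(x̄₀) is a neighborhood of x̄(t_f) = φ⁰(t_f, x̄₀) in ℝ^d, where εU = {εu : u ∈ U}. -/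
open Set MeasureTheory
open scoped Pointwise

noncomputable section

/-- A perturbation of the trivial vector field whose linearised endpoint map is the identity has a
locally surjective endpoint map. -/
theorem eventually_exists_integral_eq_of_integral_eq_id
    {E : Type*} [NormedAddCommGroup E] [NormedSpace ℝ E] [CompleteSpace E]
    (f : E → ℝ → E → E) {T L : ℝ} (hT : 0 < T) (hL : 0 ≤ L) (x₀ : E)
    (hcont : ∀ p, Continuous (fun a : ℝ × E => f p a.1 a.2))
    (hbd : ∀ p q, ∀ t ∈ Icc 0 T, ∀ z ∈ Metric.closedBall x₀ 1,
      ‖f p t z - f q t z‖ ≤ L * ‖p - q‖)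
    (hlip : ∀ p q, ∀ t ∈ Icc 0 T, ∀ z ∈ Metric.closedBall x₀ 1, ∀ z' ∈ Metric.closedBall x₀ 1,
      ‖(f p t z - f q t z) - (f p t z' - f q t z')‖ ≤ L * ‖p - q‖ * ‖z - z'‖)
    (hf0 : ∀ t z, f 0 t z = 0)
    (hint : ∀ p, ∫ t in (0 : ℝ)..T, f p t x₀ = p) {r : ℝ} (hr : 0 < r) :
    ∀ᶠ y in nhds x₀, ∃ p : E, ‖p‖ < r ∧ ∃ z : ℝ → E, Continuous z ∧
      (∀ t ∈ Icc 0 T, z t = x₀ + ∫ s in (0 : ℝ)..t, f p s (z s)) ∧ z T = y := by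
  set c := T * L with hc
  have hc0 : 0 ≤ c := by positivity
  set D := 2 * (c + 3 * c ^ 2 + 1) with hD
  have hD0 : 0 < D := by positivity
  set r₀ := min r D⁻¹ with hr₀
  have hr₀pos : 0 < r₀ := lt_min hr (inv_pos.2 hD0)
  have hr₀D : r₀ * D ≤ 1 := by
    calc r₀ * D ≤ D⁻¹ * D := by gcongr; exact min_le_right _ _
      _ = 1 := inv_mul_cancel₀ hD0.ne'
  have hcr : c * r₀ ≤ 1 / 2 := by
    have : 0 ≤ c ^ 2 * r₀ := by positivity
    nlinarith
  have hcr2 : 3 * c ^ 2 * r₀ ≤ 1 / 2 := by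
    have : 0 ≤ c * r₀ := by positivity
    nlinarith
  have hx₀ : x₀ ∈ Metric.closedBall x₀ 1 := Metric.mem_closedBall_self zero_le_one
  have hbd' : ∀ p, ∀ t ∈ Icc 0 T, ∀ z ∈ Metric.closedBall x₀ 1, ‖f p t z‖ ≤ L * ‖p‖ := by
    intro p t ht z hz
    simpa [hf0] using hbd p 0 t ht z hz
  have hlip' : ∀ p, ∀ t ∈ Icc 0 T, ∀ z ∈ Metric.closedBall x₀ 1, ∀ z' ∈ Metric.closedBall x₀ 1,
      ‖f p t z - f p t z'‖ ≤ L * ‖p‖ * ‖z - z'‖ := by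
    intro p t ht z hz z' hz'
    simpa [hf0] using hlip p 0 t ht z hz z' hz'
  have hex : ∀ p : E, ∃ z : ℝ → E, ‖p‖ < r₀ → Continuous z ∧
      (∀ t, z t ∈ Metric.closedBall x₀ 1) ∧
      ∀ t ∈ Icc 0 T, z t = x₀ + ∫ s in (0 : ℝ)..t, f p s (z s) := by
    intro p
    by_cases hp : ‖p‖ < r₀
    swap
    · exact ⟨0, fun h => absurd h hp⟩
    have hPL : IsPicardLindelof (f p) (⟨0, le_rfl, hT.le⟩ : Icc (0 : ℝ) T) x₀ 1 0
        (L * ‖p‖).toNNReal (L * ‖p‖).toNNReal := by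
      have hLp : 0 ≤ L * ‖p‖ := by positivity
      refine ⟨fun t ht => ?_, fun x _ => ?_, fun t ht x hx => ?_, ?_⟩
      · refine LipschitzOnWith.of_dist_le_mul fun z hz z' hz' => ?_
        rw [Real.coe_toNNReal _ hLp, dist_eq_norm, dist_eq_norm]
        exact hlip' p t ht z hz z' hz'
      · exact ((hcont p).comp (by fun_prop : Continuous fun t : ℝ => (t, x))).continuousOn
      · rw [Real.coe_toNNReal _ hLp]
        exact hbd' p t ht x hx
      · rw [Real.coe_toNNReal _ hLp]
        simp only [sub_zero, sub_self, NNReal.coe_one, NNReal.coe_zero]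
        rw [max_eq_left hT.le]
        have : c * ‖p‖ ≤ c * r₀ := by gcongr
        nlinarith
    have hx : x₀ ∈ Metric.closedBall x₀ ((0 : NNReal) : ℝ) := by simp
    obtain ⟨α, hα⟩ := ODE.FunSpace.exists_isFixedPt_next hPL hx
    refine ⟨α.compProj, fun _ => ⟨α.continuous_compProj, fun t => ?_, fun t ht => ?_⟩⟩
    · exact α.compProj_mem_closedBall hPL.mul_max_le
    · have h := congrArg (fun β => ODE.FunSpace.compProj β t) hα
      simp only [ODE.FunSpace.compProj_of_mem ht, ODE.FunSpace.next_apply, ODE.picard_apply] at h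
      rw [ODE.FunSpace.compProj_of_mem ht, ← h]
  choose z hz using hex
  have hii : ∀ p, ∀ w : ℝ → E, Continuous w → ∀ a b : ℝ,
      IntervalIntegrable (fun s => f p s (w s)) volume a b := fun p w hw a b =>
    ((hcont p).comp (continuous_id.prodMk hw)).intervalIntegrable a b
  have hbound : ∀ (g : ℝ → E) (C : ℝ), (∀ s ∈ Icc 0 T, ‖g s‖ ≤ C) → ∀ t ∈ Icc 0 T,
      ‖∫ s in (0 : ℝ)..t, g s‖ ≤ T * C := by
    intro g C hg t ht
    have hC : 0 ≤ C := (norm_nonneg _).trans (hg t ht)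
    have := intervalIntegral.norm_integral_le_of_norm_le_const (a := 0) (b := t) (f := g) (C := C)
      (fun s hs => by
        rw [uIoc_of_le ht.1] at hs
        exact hg s ⟨hs.1.le, hs.2.trans ht.2⟩)
    rw [sub_zero, abs_of_nonneg ht.1] at this
    calc _ ≤ C * t := this
      _ ≤ C * T := by gcongr; exact ht.2
      _ = T * C := mul_comm _ _
  have hdev : ∀ p, ‖p‖ < r₀ → ∀ t ∈ Icc 0 T, ‖z p t - x₀‖ ≤ c * r₀ := by
    intro p hp t ht
    rw [(hz p hp).2.2 t ht, add_sub_cancel_left]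
    refine (hbound _ (L * ‖p‖) (fun s hs => hbd' p s hs _ ((hz p hp).2.1 s)) t ht).trans ?_
    rw [← mul_assoc]
    gcongr
  have hdiff : ∀ p q, ‖p‖ < r₀ → ‖q‖ < r₀ → ∀ t ∈ Icc 0 T,
      ‖z p t - z q t‖ ≤ 2 * c * ‖p - q‖ := by
    intro p q hp hq t ht
    obtain ⟨s₀, hs₀, hmax⟩ := (isCompact_Icc (a := (0 : ℝ)) (b := T)).exists_isMaxOn
      ⟨0, le_rfl, hT.le⟩ ((hz p hp).1.sub (hz q hq).1).norm.continuousOn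
    have hmax' : ∀ s ∈ Icc 0 T, ‖z p s - z q s‖ ≤ ‖z p s₀ - z q s₀‖ := fun s hs => hmax hs
    have key : ‖z p s₀ - z q s₀‖ ≤ T * (L * ‖p - q‖ + L * ‖q‖ * ‖z p s₀ - z q s₀‖) := by
      have heq : z p s₀ - z q s₀ = ∫ s in (0 : ℝ)..s₀, (f p s (z p s) - f q s (z q s)) := by
        rw [intervalIntegral.integral_sub (hii p _ (hz p hp).1 _ _) (hii q _ (hz q hq).1 _ _),
          (hz p hp).2.2 s₀ hs₀, (hz q hq).2.2 s₀ hs₀, add_sub_add_left_eq_sub]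
      rw [heq]
      refine hbound _ _ (fun s hs => ?_) s₀ hs₀
      rw [← heq]
      have h1 := hbd p q s hs _ ((hz p hp).2.1 s)
      have h2 := hlip' q s hs _ ((hz p hp).2.1 s) _ ((hz q hq).2.1 s)
      have h3 : L * ‖q‖ * ‖z p s - z q s‖ ≤ L * ‖q‖ * ‖z p s₀ - z q s₀‖ := by
        gcongr
        exact hmax' s hs
      calc ‖f p s (z p s) - f q s (z q s)‖
          = ‖(f p s (z p s) - f q s (z p s)) + (f q s (z p s) - f q s (z q s))‖ := by
            rw [sub_add_sub_cancel]
        _ ≤ _ := (norm_add_le _ _).trans (by linarith)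
    have h4 : c * ‖q‖ * ‖z p s₀ - z q s₀‖ ≤ 1 / 2 * ‖z p s₀ - z q s₀‖ := by
      gcongr
      exact (mul_le_mul_of_nonneg_left hq.le hc0).trans hcr
    have h5 : T * (L * ‖p - q‖ + L * ‖q‖ * ‖z p s₀ - z q s₀‖)
        = c * ‖p - q‖ + c * ‖q‖ * ‖z p s₀ - z q s₀‖ := by rw [hc]; ring
    have := hmax' t ht
    linarith
  have hTmem : T ∈ Icc 0 T := ⟨hT.le, le_rfl⟩
  have happrox : ApproximatesLinearOn (fun p => z p T)
      ((ContinuousLinearEquiv.refl ℝ E : E ≃L[ℝ] E) : E →L[ℝ] E) (Metric.ball 0 r₀) (1 / 2) := by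
    intro p hp q hq
    rw [mem_ball_zero_iff] at hp hq
    have heq : z p T - z q T - (p - q) = ∫ s in (0 : ℝ)..T,
        ((f p s (z p s) - f q s (z q s)) - (f p s x₀ - f q s x₀)) := by
      have i1 := hii p _ (hz p hp).1 0 T
      have i2 := hii q _ (hz q hq).1 0 T
      have i3 := hii p _ (continuous_const (y := x₀)) 0 T
      have i4 := hii q _ (continuous_const (y := x₀)) 0 T
      rw [intervalIntegral.integral_sub (i1.sub i2) (i3.sub i4),
        intervalIntegral.integral_sub i1 i2, intervalIntegral.integral_sub i3 i4, hint, hint,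
        (hz p hp).2.2 T hTmem, (hz q hq).2.2 T hTmem, add_sub_add_left_eq_sub]
    have hle : ‖z p T - z q T - (p - q)‖ ≤
        T * (L * ‖p - q‖ * (c * r₀) + L * r₀ * (2 * c * ‖p - q‖)) := by
      rw [heq]
      refine hbound _ _ (fun s hs => ?_) T hTmem
      have h1 := hlip p q s hs _ ((hz p hp).2.1 s) _ hx₀
      have h2 := hlip' q s hs _ ((hz p hp).2.1 s) _ ((hz q hq).2.1 s)
      have h3 : L * ‖p - q‖ * ‖z p s - x₀‖ ≤ L * ‖p - q‖ * (c * r₀) := by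
        gcongr
        exact hdev p hp s hs
      have h4 : L * ‖q‖ * ‖z p s - z q s‖ ≤ L * r₀ * (2 * c * ‖p - q‖) := by
        gcongr
        exact hdiff p q hp hq s hs
      calc ‖(f p s (z p s) - f q s (z q s)) - (f p s x₀ - f q s x₀)‖
          = ‖((f p s (z p s) - f q s (z p s)) - (f p s x₀ - f q s x₀)) +
              (f q s (z p s) - f q s (z q s))‖ := by congr 1; abel
        _ ≤ _ := (norm_add_le _ _).trans (by linarith)
    have h5 : T * (L * ‖p - q‖ * (c * r₀) + L * r₀ * (2 * c * ‖p - q‖))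
        = 3 * c ^ 2 * r₀ * ‖p - q‖ := by rw [hc]; ring
    have h6 : 3 * c ^ 2 * r₀ * ‖p - q‖ ≤ 1 / 2 * ‖p - q‖ := by gcongr
    simp only [ContinuousLinearEquiv.coe_refl, ContinuousLinearMap.coe_id', id_eq]
    push_cast
    linarith
  have hz0 : z 0 T = x₀ := by
    have h0 : ‖(0 : E)‖ < r₀ := by simpa using hr₀pos
    rw [(hz 0 h0).2.2 T hTmem]
    simp [hf0]
  have himage := happrox.image_mem_nhds
    (ContinuousLinearEquiv.refl ℝ E).toNonlinearRightInverse
    (Metric.ball_mem_nhds (0 : E) hr₀pos) (by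
      rcases subsingleton_or_nontrivial E with h | h
      · exact Or.inl h
      · right
        change (1 / 2 : NNReal) < (‖(ContinuousLinearMap.id ℝ E)‖₊)⁻¹
        rw [ContinuousLinearMap.nnnorm_id, inv_one]
        exact one_half_lt_one)
  simp only [hz0] at himage
  filter_upwards [himage] with y hy
  obtain ⟨p, hp, rfl⟩ := hy
  rw [mem_ball_zero_iff] at hp
  exact ⟨p, hp.trans_le (min_le_left _ _), z p, (hz p hp).1, (hz p hp).2.2, rfl⟩

/-- A dense convex subset of a finite-dimensional space is the whole space. -/
theorem Convex.eq_univ_of_dense {E : Type*} [NormedAddCommGroup E] [NormedSpace ℝ E]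
    [FiniteDimensional ℝ E] {s : Set E} (hs : Convex ℝ s) (hd : Dense s) : s = univ := by
  have hspan : affineSpan ℝ s = ⊤ := by
    have hcl : IsClosed (affineSpan ℝ s : Set E) := AffineSubspace.closed_of_finiteDimensional _
    have : (univ : Set E) ⊆ affineSpan ℝ s := by
      rw [← hd.closure_eq]
      exact hcl.closure_subset_iff.2 (subset_affineSpan ℝ s)
    exact SetLike.coe_injective (univ_subset_iff.1 this)
  have hne := (hs.interior_nonempty_iff_affineSpan_eq_top).2 hspan
  have h := hs.interior_closure_eq_interior_of_nonempty_interior hne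
  rw [hd.closure_eq, interior_univ] at h
  exact univ_subset_iff.1 (h.subset.trans interior_subset)

/-- Dilates of a convex set containing the origin increase with the dilation factor. -/
theorem Convex.smul_subset_smul_of_le {V : Type*} [AddCommGroup V] [Module ℝ V] {U : Set V}
    (hU : Convex ℝ U) (h0 : (0 : V) ∈ U) {a b : ℝ} (ha : 0 ≤ a) (hab : a ≤ b) :
    a • U ⊆ b • U := by
  rintro _ ⟨u, hu, rfl⟩
  rcases eq_or_lt_of_le (ha.trans hab) with hb | hb
  · have : a = b := le_antisymm hab (hb ▸ ha)
    exact this ▸ smul_mem_smul_set hu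
  · refine ⟨(a / b) • u, hU.smul_mem_of_zero_mem h0 hu ⟨by positivity, (div_le_one hb).2 hab⟩, ?_⟩
    simp only [smul_smul]
    rw [mul_div_cancel₀ _ hb.ne']

theorem Convex.sum_smul_mem_smul {V ι : Type*} [AddCommGroup V] [Module ℝ V] {U : Set V}
    (hU : Convex ℝ U) (h0 : (0 : V) ∈ U) (s : Finset ι) {c M : ι → ℝ} {v : ι → V}
    (hc : ∀ i, 0 ≤ c i) (hM : ∀ i, 0 ≤ M i) (hv : ∀ i, v i ∈ M i • U) :
    ∑ i ∈ s, c i • v i ∈ (∑ i ∈ s, c i * M i) • U := by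
  classical
  induction s using Finset.induction_on with
  | empty => exact ⟨0, h0, by simp⟩
  | insert i s hi ih =>
    rw [Finset.sum_insert hi, Finset.sum_insert hi,
      hU.add_smul (mul_nonneg (hc i) (hM i))
        (Finset.sum_nonneg fun j _ => mul_nonneg (hc j) (hM j)), mul_smul]
    exact add_mem_add (smul_mem_smul_set (hv i)) ih

/-- The cone of averages `∫₀ᵀ ∑ₖ vₖ(t) yₖ(t) dt` over continuous controls `v` taking values in some
nonnegative dilate of `U`. -/
def averageCone {m : ℕ} {E : Type*} [NormedAddCommGroup E] [NormedSpace ℝ E]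
    (y : Fin m → ℝ → E) (hy : ∀ k, Continuous (y k)) (U : Set (Fin m → ℝ)) (hU : Convex ℝ U)
    (h0 : (0 : Fin m → ℝ) ∈ U) (T : ℝ) : PointedCone ℝ E where
  carrier := {w | ∃ v : ℝ → Fin m → ℝ, Continuous v ∧ (∃ M : ℝ, 0 ≤ M ∧ ∀ t, v t ∈ M • U) ∧
    ∫ t in (0 : ℝ)..T, ∑ k, v t k • y k t = w}
  zero_mem' := ⟨0, continuous_const, ⟨0, le_rfl, fun _ => ⟨0, h0, by simp⟩⟩, by simp⟩
  add_mem' := by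
    rintro _ _ ⟨v, hv, ⟨M, hM, hvM⟩, rfl⟩ ⟨v', hv', ⟨M', hM', hvM'⟩, rfl⟩
    refine ⟨v + v', hv.add hv', ⟨M + M', add_nonneg hM hM', fun t => ?_⟩, ?_⟩
    · rw [hU.add_smul hM hM']
      exact add_mem_add (hvM t) (hvM' t)
    · rw [← intervalIntegral.integral_add
        (Continuous.intervalIntegrable (by fun_prop) _ _)
        (Continuous.intervalIntegrable (by fun_prop) _ _)]
      simp [add_smul, Finset.sum_add_distrib]
  smul_mem' := by
    rintro ⟨c, hc⟩ _ ⟨v, hv, ⟨M, hM, hvM⟩, rfl⟩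
    refine ⟨fun t => c • v t, by fun_prop, ⟨c * M, mul_nonneg hc hM, fun t => ?_⟩, ?_⟩
    · rw [mul_smul]
      exact smul_mem_smul_set (hvM t)
    · rw [Nonneg.mk_smul, ← intervalIntegral.integral_smul]
      simp [mul_smul, Finset.smul_sum]

/-- If the values `∑ₖ uₖ yₖ(τ)`, for `u ∈ U` and `τ ∈ [0, T]`, positively span the space, then every
vector is an average `∫₀ᵀ ∑ₖ vₖ(t) yₖ(t) dt` for some continuous control `v`. -/
theorem mem_averageCone_of_coneHull_eq_univ {m : ℕ} {E : Type*} [NormedAddCommGroup E]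
    [NormedSpace ℝ E] [FiniteDimensional ℝ E]
    (y : Fin m → ℝ → E) (hy : ∀ k, Continuous (y k)) (U : Set (Fin m → ℝ)) (hU : Convex ℝ U)
    (h0 : (0 : Fin m → ℝ) ∈ U) {T : ℝ} (hT : 0 < T) {S : Set E}
    (hS : ∀ v ∈ S, ∃ τ ∈ Icc 0 T, ∃ u ∈ U, v = ∑ k, u k • y k τ)
    (hcone : coneHull S = univ) (w : E) : w ∈ averageCone y hy U hU h0 T := by
  have hSC : S ⊆ closure (averageCone y hy U hU h0 T : Set E) := by
    intro v hv
    obtain ⟨τ, hτ, u, hu, rfl⟩ := hS v hv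
    set g : ℝ → E := fun t => ∑ k, u k • y k t with hg
    have hgc : Continuous g := by fun_prop
    change g τ ∈ _
    rw [Metric.mem_closure_iff]
    intro δ hδ
    obtain ⟨η, hη, hclose⟩ := Metric.continuous_iff.1 hgc τ (δ / 2) (half_pos hδ)
    set ρ : ℝ → ℝ := fun t => max (η - |t - τ|) 0 with hρ
    have hρc : Continuous ρ := by fun_prop
    have hρ0 : ∀ t, 0 ≤ ρ t := fun t => le_max_right _ _
    have hρη : ∀ t, ρ t ≤ η := fun t => max_le (by linarith [abs_nonneg (t - τ)]) hη.le
    have hI : 0 < ∫ t in (0 : ℝ)..T, ρ t :=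
      intervalIntegral.integral_pos hT hρc.continuousOn (fun t _ => hρ0 t)
        ⟨τ, hτ, by simp [hρ, hη]⟩
    set I := ∫ t in (0 : ℝ)..T, ρ t
    have hmem : (∫ t in (0 : ℝ)..T, ρ t • g t) ∈ averageCone y hy U hU h0 T := by
      refine ⟨fun t => ρ t • u, by fun_prop, ⟨η, hη.le, fun t => ?_⟩, ?_⟩
      · exact hU.smul_subset_smul_of_le h0 (hρ0 t) (hρη t) (smul_mem_smul_set hu)
      · simp [hg, Finset.smul_sum, mul_smul]
    refine ⟨I⁻¹ • ∫ t in (0 : ℝ)..T, ρ t • g t,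
      (averageCone y hy U hU h0 T).smul_mem (inv_pos.2 hI).le hmem, ?_⟩
    have hsub : g τ - I⁻¹ • ∫ t in (0 : ℝ)..T, ρ t • g t
        = I⁻¹ • ∫ t in (0 : ℝ)..T, ρ t • (g τ - g t) := by
      simp only [smul_sub]
      rw [intervalIntegral.integral_sub (Continuous.intervalIntegrable (by fun_prop) _ _)
        (Continuous.intervalIntegrable (by fun_prop) _ _), intervalIntegral.integral_smul_const,
        smul_sub, smul_smul, inv_mul_cancel₀ hI.ne', one_smul]
    have hnorm : ‖∫ t in (0 : ℝ)..T, ρ t • (g τ - g t)‖ ≤ ∫ t in (0 : ℝ)..T, ρ t * (δ / 2) := by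
      refine intervalIntegral.norm_integral_le_of_norm_le hT.le (Filter.Eventually.of_forall
        fun t _ => ?_) (Continuous.intervalIntegrable (by fun_prop) _ _)
      rw [norm_smul, Real.norm_of_nonneg (hρ0 t)]
      rcases lt_or_ge |t - τ| η with h | h
      · gcongr
        rw [norm_sub_rev, ← dist_eq_norm]
        exact (hclose t (by rwa [Real.dist_eq])).le
      · have : ρ t = 0 := max_eq_right (by linarith)
        simp [this]
    rw [intervalIntegral.integral_mul_const] at hnorm
    rw [dist_eq_norm, hsub, norm_smul, Real.norm_of_nonneg (inv_pos.2 hI).le]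
    calc _ ≤ I⁻¹ * (I * (δ / 2)) := by gcongr
      _ = δ / 2 := by rw [← mul_assoc, inv_mul_cancel₀ hI.ne', one_mul]
      _ < δ := half_lt_self hδ
  have hdense : Dense (averageCone y hy U hU h0 T : Set E) := by
    intro x
    have hx : x ∈ coneHull S := hcone ▸ mem_univ x
    obtain ⟨j, v, c, hv, hc, rfl⟩ := hx
    change _ ∈ (averageCone y hy U hU h0 T).topologicalClosure
    exact Submodule.sum_mem _ fun i _ => Submodule.smul_mem
      (averageCone y hy U hU h0 T).topologicalClosure (⟨c i, hc i⟩ : {c : ℝ // 0 ≤ c})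
      (hSC (hv i))
  have hconv : Convex ℝ (averageCone y hy U hU h0 T : Set E) := PointedCone.convex _
  have huniv := hconv.eq_univ_of_dense hdense
  exact SetLike.mem_coe.1 (huniv ▸ mem_univ w)

theorem contDiff_pushf {d : ℕ} {φ : ℝ → Ed d → Ed d} {Z : Ed d → Ed d}
    (hφ : ContDiff ℝ (⊤ : ℕ∞) (fun p : ℝ × Ed d => φ p.1 p.2)) (hZ : ContDiff ℝ (⊤ : ℕ∞) Z) :
    ContDiff ℝ (⊤ : ℕ∞) (fun a : ℝ × Ed d => pushf φ Z a.1 a.2) := by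
  have h1 : ContDiff ℝ (⊤ : ℕ∞)
      (Function.uncurry fun (a : ℝ × Ed d) (x : Ed d) => φ (-a.1) x) :=
    hφ.comp (g := fun p : ℝ × Ed d => φ p.1 p.2)
      (f := fun q : (ℝ × Ed d) × Ed d => (-q.1.1, q.2)) (by fun_prop)
  exact (h1.fderiv (m := (⊤ : ℕ∞)) hφ (by simp)).clm_apply (hZ.comp hφ)

/-- Pushing forward by the flow undoes `pushf`. -/
theorem fderiv_flow_pushf {d : ℕ} {φ : ℝ → Ed d → Ed d} (Z : Ed d → Ed d)
    (hφ : ContDiff ℝ (⊤ : ℕ∞) (fun p : ℝ × Ed d => φ p.1 p.2)) (hφ0 : ∀ x, φ 0 x = x)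
    (hφadd : ∀ s t x, φ (s + t) x = φ s (φ t x)) (t : ℝ) (x : Ed d) :
    fderiv ℝ (φ t) x (pushf φ Z t x) = Z (φ t x) := by
  have hd : ∀ s, Differentiable ℝ (φ s) := fun s =>
    (hφ.comp (g := fun p : ℝ × Ed d => φ p.1 p.2) (f := fun z : Ed d => (s, z))
      (by fun_prop)).differentiable (by simp)
  have hinv : φ (-t) (φ t x) = x := by rw [← hφadd, neg_add_cancel, hφ0]
  have hid : φ t ∘ φ (-t) = id := by
    funext z
    rw [Function.comp_apply, ← hφadd, add_neg_cancel, hφ0, id]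
  have hcomp := fderiv_comp (φ t x) (hd t _) (hd (-t) (φ t x))
  rw [hid, fderiv_id, hinv] at hcomp
  exact (congrArg (fun A => A (Z (φ t x))) hcomp).symm

/-- A curve driven by the pulled-back control fields is carried by the drift flow to a solution of
the control system. -/
theorem flow_mem_access_of_pushf_integral {d m : ℕ} {X0 : Ed d → Ed d} {X : Fin m → Ed d → Ed d}
    (hX0 : Continuous X0) (hX : ∀ k, ContDiff ℝ (⊤ : ℕ∞) (X k))
    {φ : ℝ → Ed d → Ed d}
    (hφ : ContDiff ℝ (⊤ : ℕ∞) (fun p : ℝ × Ed d => φ p.1 p.2)) (hφ0 : ∀ x, φ 0 x = x)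
    (hφadd : ∀ s t x, φ (s + t) x = φ s (φ t x))
    (hφder : ∀ t x, HasDerivAt (fun τ => φ τ x) (X0 (φ t x)) t)
    {V : Set (Fin m → ℝ)} {T : ℝ} (hT : 0 ≤ T) {x₀ : Ed d}
    {u : ℝ → Fin m → ℝ} (hu : Continuous u) (huV : ∀ t, u t ∈ V)
    {z : ℝ → Ed d} (hz : Continuous z)
    (hzint : ∀ t ∈ Icc 0 T, z t = x₀ + ∫ s in (0 : ℝ)..t, ∑ k, u s k • pushf φ (X k) s (z s)) :
    φ T (z T) ∈ Access X0 X V T x₀ := by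
  have hxc : Continuous fun t => φ t (z t) := hφ.continuous.comp (continuous_id.prodMk hz)
  have hrhs : Continuous fun s => X0 (φ s (z s)) + ∑ k, u s k • X k (φ s (z s)) := by
    have := fun k => (hX k).continuous
    fun_prop
  have hgc : Continuous fun s => ∑ k, u s k • pushf φ (X k) s (z s) := by
    have := fun k => (contDiff_pushf hφ (hX k)).continuous.comp (continuous_id.prodMk hz)
    simp only [Function.comp_def, id] at this
    fun_prop
  have hz0 : z 0 = x₀ := by simpa using hzint 0 ⟨le_rfl, hT⟩
  have hzder : ∀ t ∈ Ioo 0 T, HasDerivAt z (∑ k, u t k • pushf φ (X k) t (z t)) t := by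
    intro t ht
    have h := (intervalIntegral.integral_hasDerivAt_right (hgc.intervalIntegrable 0 t)
      hgc.aestronglyMeasurable.stronglyMeasurableAtFilter hgc.continuousAt).const_add x₀
    refine h.congr_of_eventuallyEq ?_
    filter_upwards [Ioo_mem_nhds ht.1 ht.2] with s hs
    exact hzint s (Ioo_subset_Icc_self hs)
  have hxder : ∀ t ∈ Ioo 0 T, HasDerivAt (fun t => φ t (z t))
      (X0 (φ t (z t)) + ∑ k, u t k • X k (φ t (z t))) t := by
    intro t ht
    set Φ : ℝ × Ed d → Ed d := fun p => φ p.1 p.2 with hΦ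
    have hΦd : HasFDerivAt Φ (fderiv ℝ Φ (t, z t)) (t, z t) :=
      (hφ.differentiable (by simp) _).hasFDerivAt
    have htime : fderiv ℝ Φ (t, z t) (1, 0) = X0 (φ t (z t)) :=
      (hΦd.comp_hasDerivAt (f := fun τ : ℝ => (τ, z t)) t
        ((hasDerivAt_id t).prodMk (hasDerivAt_const t (z t)))).unique (hφder t (z t))
    have hspace : ∀ w, fderiv ℝ Φ (t, z t) (0, w) = fderiv ℝ (φ t) (z t) w := by
      intro w
      have h := (hΦd.comp (f := fun ζ : Ed d => (t, ζ)) (z t)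
        ((hasFDerivAt_const t (z t)).prodMk (hasFDerivAt_id (z t)))).fderiv
      have h' : fderiv ℝ (φ t) (z t) = _ := h
      rw [h']
      simp
    have h := hΦd.comp_hasDerivAt (f := fun τ : ℝ => (τ, z τ)) t
      ((hasDerivAt_id t).prodMk (hzder t ht))
    have hsplit : fderiv ℝ Φ (t, z t) (1, ∑ k, u t k • pushf φ (X k) t (z t))
        = X0 (φ t (z t)) + ∑ k, u t k • X k (φ t (z t)) := by
      rw [show ((1 : ℝ), ∑ k, u t k • pushf φ (X k) t (z t))
        = ((1 : ℝ), (0 : Ed d)) + (0, ∑ k, u t k • pushf φ (X k) t (z t)) by simp, map_add, htime,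
        hspace, map_sum]
      simp_rw [map_smul, fderiv_flow_pushf _ hφ hφ0 hφadd]
    rw [hsplit] at h
    exact h
  refine ⟨fun t => φ t (z t), u, ⟨hu.measurable, fun t _ => huV t, ?_,
    hrhs.intervalIntegrable _ _, fun t ht => ?_⟩, by simp only [hφ0, hz0], rfl⟩
  · exact isCompact_Icc.exists_bound_of_continuousOn hu.continuousOn
  · rw [intervalIntegral.integral_eq_sub_of_hasDerivAt_of_le ht.1 hxc.continuousOn
      (fun s hs => hxder s ⟨hs.1, hs.2.trans_le ht.2⟩) (hrhs.intervalIntegrable _ _)]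
    abel

/-- Continuous controls depending on `p` in a Lipschitz way whose averages against `y` equal `p`. -/
theorem exists_control_family {d m : ℕ} (y : Fin m → ℝ → Ed d) (hy : ∀ k, Continuous (y k))
    (U : Set (Fin m → ℝ)) (hU : Convex ℝ U) (h0 : (0 : Fin m → ℝ) ∈ U) {T : ℝ}
    (hall : ∀ w, w ∈ averageCone y hy U hU h0 T) :
    ∃ u : Ed d → ℝ → Fin m → ℝ, (∀ p, Continuous (u p)) ∧ (∀ t, u 0 t = 0) ∧
      (∃ M : ℝ, 0 ≤ M ∧ ∀ p t, u p t ∈ (‖p‖ * M) • U) ∧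
      (∃ C : ℝ, 0 ≤ C ∧ ∀ p q, ∀ t ∈ Icc 0 T, ‖u p t - u q t‖ ≤ C * ‖p - q‖) ∧
      ∀ p, ∫ t in (0 : ℝ)..T, ∑ k, u p t k • y k t = p := by
  set sg : Bool → ℝ := fun b => if b then 1 else -1 with hsg
  set e : Fin d × Bool → Ed d := fun j => sg j.2 • EuclideanSpace.basisFun (Fin d) ℝ j.1 with he
  set c : Ed d → Fin d × Bool → ℝ := fun p j => max (sg j.2 * p j.1) 0 with hc
  have hsg1 : ∀ b, |sg b| = 1 := by rintro (_ | _) <;> simp [hsg]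
  have hc0 : ∀ p j, 0 ≤ c p j := fun p j => le_max_right _ _
  have hcz : ∀ j, c 0 j = 0 := fun j => by simp [hc]
  have hcl : ∀ p q j, |c p j - c q j| ≤ ‖p - q‖ := by
    intro p q j
    calc |c p j - c q j| ≤ |sg j.2 * p j.1 - sg j.2 * q j.1| := abs_max_sub_max_le_abs _ _ _
      _ = |(p - q) j.1| := by rw [← mul_sub, abs_mul, hsg1, one_mul]; rfl
      _ ≤ ‖p - q‖ := PiLp.norm_apply_le (p - q) j.1
  have hcp : ∀ p j, c p j ≤ ‖p‖ := fun p j => by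
    simpa [hcz, abs_of_nonneg (hc0 p j)] using hcl p 0 j
  have hce : ∀ p, ∑ j, c p j • e j = p := by
    intro p
    rw [Fintype.sum_prod_type]
    conv_rhs => rw [← (EuclideanSpace.basisFun (Fin d) ℝ).sum_repr p]
    refine Finset.sum_congr rfl fun i _ => ?_
    simp only [Fintype.sum_bool, hc, he, hsg, smul_smul, ← add_smul,
      EuclideanSpace.basisFun_repr]
    congr 1
    rcases le_total 0 (p i) with h | h <;> simp [h]
  choose v hv hdilate hmean using fun j => hall (e j)
  choose M hM hvM using hdilate
  have hB : ∀ j, ∃ B, ∀ t ∈ Icc 0 T, ‖v j t‖ ≤ B := fun j =>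
    isCompact_Icc.exists_bound_of_continuousOn (hv j).continuousOn
  choose B hB using hB
  refine ⟨fun p t => ∑ j, c p j • v j t, fun p => by fun_prop, fun t => by simp [hcz],
    ⟨∑ j, M j, Finset.sum_nonneg fun j _ => hM j, fun p t => ?_⟩,
    ⟨∑ j, |B j|, Finset.sum_nonneg fun j _ => abs_nonneg _, fun p q t ht => ?_⟩, fun p => ?_⟩
  · refine hU.smul_subset_smul_of_le h0
      (Finset.sum_nonneg fun j _ => mul_nonneg (hc0 p j) (hM j)) ?_
      (hU.sum_smul_mem_smul h0 Finset.univ (hc0 p) hM fun j => hvM j t)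
    rw [Finset.mul_sum]
    exact Finset.sum_le_sum fun j _ => mul_le_mul_of_nonneg_right (hcp p j) (hM j)
  · rw [← Finset.sum_sub_distrib, Finset.sum_mul]
    refine norm_sum_le_of_le _ fun j _ => ?_
    rw [← sub_smul, norm_smul, mul_comm]
    exact mul_le_mul ((hB j t ht).trans (le_abs_self _)) (hcl p q j) (norm_nonneg _) (abs_nonneg _)
  · have hswap : ∀ t, ∑ k, (∑ j, c p j • v j t) k • y k t
        = ∑ j, c p j • ∑ k, v j t k • y k t := by
      intro t
      simp only [Finset.sum_apply, Pi.smul_apply, Finset.sum_smul, Finset.smul_sum, smul_eq_mul,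
        mul_smul]
      exact Finset.sum_comm
    simp only [hswap]
    rw [intervalIntegral.integral_finsetSum fun j _ =>
      Continuous.intervalIntegrable (by fun_prop) _ _]
    simp only [intervalIntegral.integral_smul, hmean, hce]

/-- Uniform bound and Lipschitz constant, over a compact time interval and the unit ball, for the
linear combinations of finitely many `C^∞` time-dependent vector fields. -/
theorem exists_bound_lipschitz_sum_smul {m : ℕ} {E : Type*} [NormedAddCommGroup E]
    [NormedSpace ℝ E] [FiniteDimensional ℝ E] (Y : Fin m → ℝ → E → E)
    (hY : ∀ k, ContDiff ℝ (⊤ : ℕ∞) (fun a : ℝ × E => Y k a.1 a.2)) (T : ℝ) (x₀ : E) :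
    ∃ L : ℝ, 0 ≤ L ∧ ∀ w : Fin m → ℝ, ∀ t ∈ Icc 0 T, ∀ z ∈ Metric.closedBall x₀ 1,
      ‖∑ k, w k • Y k t z‖ ≤ L * ‖w‖ ∧ ∀ z' ∈ Metric.closedBall x₀ 1,
        ‖∑ k, w k • Y k t z - ∑ k, w k • Y k t z'‖ ≤ L * ‖w‖ * ‖z - z'‖ := by
  have hcpt : IsCompact (Icc 0 T ×ˢ Metric.closedBall x₀ 1) :=
    isCompact_Icc.prod (isCompact_closedBall x₀ 1)
  choose B hB using fun k => hcpt.exists_bound_of_continuousOn (hY k).continuous.continuousOn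
  have hlip : ∀ k, ∃ K, LipschitzOnWith K (fun a : ℝ × E => Y k a.1 a.2)
      (Icc 0 T ×ˢ Metric.closedBall x₀ 1) := fun k =>
    (((hY k).of_le (by simp)).locallyLipschitz.locallyLipschitzOn).exists_lipschitzOnWith_of_compact
      hcpt
  choose K hK using hlip
  have hpart : ∀ k, 0 ≤ |B k| + K k := fun k => add_nonneg (abs_nonneg _) (K k).coe_nonneg
  refine ⟨∑ k, (|B k| + K k), Finset.sum_nonneg fun k _ => hpart k, fun w t ht z hz =>
    ⟨?_, fun z' hz' => ?_⟩⟩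
  · rw [Finset.sum_mul]
    refine norm_sum_le_of_le _ fun k _ => ?_
    rw [norm_smul, mul_comm]
    refine mul_le_mul ?_ (norm_le_pi_norm w k) (norm_nonneg _) (hpart k)
    exact ((hB k (t, z) ⟨ht, hz⟩).trans (le_abs_self _)).trans
      (le_add_of_nonneg_right (K k).coe_nonneg)
  · rw [← Finset.sum_sub_distrib, mul_assoc, Finset.sum_mul]
    refine norm_sum_le_of_le _ fun k _ => ?_
    have h := (hK k).dist_le_mul (t, z) ⟨ht, hz⟩ (t, z') ⟨ht, hz'⟩
    rw [dist_eq_norm, Prod.dist_eq, dist_self, max_eq_right dist_nonneg, dist_eq_norm] at h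
    rw [← smul_sub, norm_smul]
    calc ‖w k‖ * ‖Y k t z - Y k t z'‖ ≤ ‖w‖ * ((|B k| + K k) * ‖z - z'‖) := by
          refine mul_le_mul (norm_le_pi_norm w k) (h.trans ?_) (norm_nonneg _) (norm_nonneg _)
          gcongr
          exact le_add_of_nonneg_left (abs_nonneg _)
      _ = _ := by ring

/-- Theorem 3.5, part I: if `cone Ē = ℝ^d` where `Ē = E^U_{[0,t_f]}(x̄₀)`, then for every
`ε > 0` the accessible set `A^{εU}_{t_f}(x̄₀)` is a neighborhood of `φ⁰(t_f, x̄₀)`. -/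
theorem local_controllability_along_drift
    {d m : ℕ}
    (X0 : Ed d → Ed d) (X : Fin m → Ed d → Ed d) (U : Set (Fin m → ℝ))
    (hX0 : ContDiff ℝ (⊤ : ℕ∞) X0) (hX : ∀ k, ContDiff ℝ (⊤ : ℕ∞) (X k))
    (hUconv : Convex ℝ U) (hUcomp : IsCompact U) (hU0 : (0 : Fin m → ℝ) ∈ U)
    (φ : ℝ → Ed d → Ed d)
    (hφsmooth : ContDiff ℝ (⊤ : ℕ∞) (fun p : ℝ × Ed d => φ p.1 p.2))
    (hφ0 : ∀ x, φ 0 x = x)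
    (hφadd : ∀ s t x, φ (s + t) x = φ s (φ t x))
    (hφder : ∀ t x, HasDerivAt (fun τ => φ τ x) (X0 (φ t x)) t)
    (tf : ℝ) (htf : 0 < tf) (xbar0 : Ed d)
    (hcone : coneHull (EIcc φ X U 0 tf xbar0) = univ) :
    ∀ ε : ℝ, 0 < ε → Access X0 X (ε • U) tf xbar0 ∈ nhds (φ tf xbar0) := by
  
  intro ε hε
  set Y : Fin m → ℝ → Ed d → Ed d := fun k t z => pushf φ (X k) t z with hYdef
  have hY : ∀ k, ContDiff ℝ (⊤ : ℕ∞) (fun a : ℝ × Ed d => Y k a.1 a.2) := fun k =>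
    contDiff_pushf hφsmooth (hX k)
  have hy : ∀ k, Continuous fun t => Y k t xbar0 := fun k =>
    (hY k).continuous.comp (by fun_prop : Continuous fun t : ℝ => (t, xbar0))
  have hall : ∀ w, w ∈ averageCone (fun k t => Y k t xbar0) hy U hUconv hU0 tf := by
    refine mem_averageCone_of_coneHull_eq_univ _ hy U hUconv hU0 htf (fun v hv => ?_) hcone
    obtain ⟨τ, hτ, u, hu, rfl⟩ := mem_iUnion₂.1 hv
    exact ⟨τ, hτ, u, hu, rfl⟩
  obtain ⟨u, huc, hu0, ⟨M, hM, huM⟩, ⟨C, hC, huL⟩, hmean⟩ :=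
    exists_control_family _ hy U hUconv hU0 hall
  obtain ⟨L, hL, hYL⟩ := exists_bound_lipschitz_sum_smul Y hY tf xbar0
  have hsub : ∀ p q t z, ∑ k, u p t k • Y k t z - ∑ k, u q t k • Y k t z
      = ∑ k, (u p t - u q t) k • Y k t z := fun p q t z => by
    simp [sub_smul]
  have hcontrol : ∀ p q, ∀ t ∈ Icc 0 tf, L * ‖u p t - u q t‖ ≤ L * C * ‖p - q‖ :=
    fun p q t ht => by
      rw [mul_assoc]
      exact mul_le_mul_of_nonneg_left (huL p q t ht) hL
  have hev := eventually_exists_integral_eq_of_integral_eq_id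
    (fun p t z => ∑ k, u p t k • Y k t z) htf (mul_nonneg hL hC) xbar0
    (fun p => by
      have := fun k => (hY k).continuous
      have := huc p
      fun_prop)
    (fun p q t ht z hz => by
      rw [hsub]
      exact (hYL _ t ht z hz).1.trans (hcontrol p q t ht))
    (fun p q t ht z hz z' hz' => by
      rw [hsub, hsub]
      exact ((hYL _ t ht z hz).2 z' hz').trans
        (mul_le_mul_of_nonneg_right (hcontrol p q t ht) (norm_nonneg _)))
    (fun t z => by simp [hu0]) hmean (r := ε / (M + 1)) (by positivity)
  have hback : Continuous (φ (-tf)) :=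
    hφsmooth.continuous.comp (by fun_prop : Continuous fun x : Ed d => (-tf, x))
  have htend : Filter.Tendsto (φ (-tf)) (nhds (φ tf xbar0)) (nhds xbar0) :=
    hback.tendsto' _ _ (by rw [← hφadd, neg_add_cancel, hφ0])
  filter_upwards [htend.eventually hev] with x hx
  obtain ⟨p, hp, z, hzc, hzint, hzx⟩ := hx
  have hxz : φ tf (z tf) = x := by rw [hzx, ← hφadd, add_neg_cancel, hφ0]
  rw [← hxz]
  refine flow_mem_access_of_pushf_integral hX0.continuous hX hφsmooth hφ0 hφadd hφder htf.le
    (huc p) (fun t => ?_) hzc hzint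
  refine hUconv.smul_subset_smul_of_le hU0 (by positivity) ?_ (huM p t)
  rw [lt_div_iff₀ (by positivity)] at hp
  nlinarith [norm_nonneg p]
end
end
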